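/- arXiv:2410.22301 — 2 statements merged into one kernel-verified Lean document; each statement's English description precedes it below -/
import Mathlib

section
/- Let $0 < r \le 1$, $0 < p \le r$, $1 \le q < \infty$, and let $u, v, w$ be weights on $(a,b)$ with $0 < \int_x^b w < \infty$ for all $x \in (a,b)$. Define $V_r(x,t) = \big(\int_x^t v^{1/(1-r)}\big)^{(1-r)/r}$ if $0<r<1$ and $V_r(x,t) = \operatorname{ess\,sup}_{s\in(x,t)} v(s)$ if $r=1$. Then the inequality $\big(\int_a^b \big(\int_a^t f^r v\big)^{q/r} u\,dt\big)^{1/q} \le C \big(\int_a^b \big(\int_a^t f\big)^{p} w\,dt\big)^{1/p}$ holds for all nonnegative measurable $f$ on $(a,b)$ if and only if $C_1 := \operatorname{ess\,sup}_{x\in(a,b)} \big(\int_x^b w\big)^{-1/p} \operatorname{ess\,sup}_{t\in(x,b)} \big(\int_t^b u\big)^{1/q} V_r(x,t) < \infty$; moreover the best constant $C$ satisfies $C \approx C_1$ with equivalence constants depending only on $p,q,r$. -/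
open MeasureTheory Set ENNReal

noncomputable section

/-- `w` is a weight on `(a,b)`: measurable, positive and finite there. -/
def IsWeight (a b : ℝ) (w : ℝ → ℝ≥0∞) : Prop :=
  Measurable w ∧ ∀ x ∈ Set.Ioo a b, 0 < w x ∧ w x < ∞

/-- The quantity `V_r(x,t)`: `(∫_x^t v^{1/(1-r)})^{(1-r)/r}` for `0 < r < 1`,
and `ess sup_{(x,t)} v` for `r = 1`. -/
def Vr (r : ℝ) (v : ℝ → ℝ≥0∞) (x t : ℝ) : ℝ≥0∞ :=
  if r = 1 then essSup v (volume.restrict (Set.Ioo x t))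
  else (∫⁻ s in Set.Ioo x t, v s ^ (1 / (1 - r))) ^ ((1 - r) / r)

/-- The Cesàro–Cesàro inequality (2.2) with constant `C`:
`(∫_a^b (∫_a^t f^r v)^{q/r} u dt)^{1/q} ≤ C (∫_a^b (∫_a^t f)^p w dt)^{1/p}`
for all nonnegative measurable `f` on `(a,b)`. -/
def CesCesIneq (a b r p q : ℝ) (u v w : ℝ → ℝ≥0∞) (C : ℝ≥0∞) : Prop :=
  ∀ f : ℝ → ℝ≥0∞, Measurable f →
    (∫⁻ t in Set.Ioo a b, (∫⁻ s in Set.Ioo a t, f s ^ r * v s) ^ (q / r) * u t) ^ (1 / q) ≤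
      C * (∫⁻ t in Set.Ioo a b, (∫⁻ s in Set.Ioo a t, f s) ^ p * w t) ^ (1 / p)

/-- The best (least) constant in the Cesàro–Cesàro inequality. -/
def BestC (a b r p q : ℝ) (u v w : ℝ → ℝ≥0∞) : ℝ≥0∞ :=
  sInf {C | CesCesIneq a b r p q u v w C}

def C₁ (a b r p q : ℝ) (u v w : ℝ → ℝ≥0∞) : ℝ≥0∞ :=
  essSup (fun x => (∫⁻ t in Set.Ioo x b, w t) ^ (-(1 / p)) *
      essSup (fun t => (∫⁻ s in Set.Ioo t b, u s) ^ (1 / q) * Vr r v x t)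
        (volume.restrict (Set.Ioo x b)))
    (volume.restrict (Set.Ioo a b))

def C₂ (a b r p q : ℝ) (u v w : ℝ → ℝ≥0∞) : ℝ≥0∞ :=
  ⨆ x ∈ Set.Ioo a b, (∫⁻ t in Set.Ioo x b, w t) ^ (-(1 / p)) *
    (∫⁻ t in Set.Ioo x b,
        (∫⁻ s in Set.Ioo t b, u s) ^ (q / (1 - q)) * u t * Vr r v x t ^ (q / (1 - q))) ^
      ((1 - q) / q)

def C₃ (a b r p q : ℝ) (u v w : ℝ → ℝ≥0∞) : ℝ≥0∞ :=
  ⨆ x ∈ Set.Ioo a b, (∫⁻ t in Set.Ioo x b, u t) ^ (1 / q) *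
    (∫⁻ t in Set.Ioo a x,
        (∫⁻ s in Set.Ioo t b, w s) ^ (-(p / (p - r))) * w t * Vr r v t x ^ (p * r / (p - r))) ^
      ((p - r) / (p * r))

def C₄ (a b r p q : ℝ) (u v w : ℝ → ℝ≥0∞) : ℝ≥0∞ :=
  (∫⁻ x in Set.Ioo a b, (∫⁻ s in Set.Ioo x b, u s) ^ (q / (p - q)) * u x *
      essSup (fun t => (∫⁻ s in Set.Ioo t b, w s) ^ (-(q / (p - q))) *
          Vr r v t x ^ (p * q / (p - q)))
        (volume.restrict (Set.Ioo a x))) ^ ((p - q) / (p * q))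

def C₅ (a b r p q : ℝ) (u v w : ℝ → ℝ≥0∞) : ℝ≥0∞ :=
  (∫⁻ x in Set.Ioo a b, w x *
      ⨆ y ∈ Set.Ioo a x, (∫⁻ s in Set.Ioo y b, w s) ^ (-(p / (p - q))) *
        (∫⁻ t in Set.Ioo y x,
            (∫⁻ s in Set.Ioo t x, u s) ^ (q / (1 - q)) * u t * Vr r v y t ^ (q / (1 - q))) ^
          (p * (1 - q) / (p - q))) ^ ((p - q) / (p * q))

def C₆ (a b r p q : ℝ) (u v w : ℝ → ℝ≥0∞) : ℝ≥0∞ :=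
  (∫⁻ x in Set.Ioo a b, w x *
      essSup (fun y => (∫⁻ s in Set.Ioo y b, w s)⁻¹ *
          (∫⁻ t in Set.Ioo y x, (∫⁻ s in Set.Ioo t b, u s) ^ (q / (p - q)) * u t *
              (∫⁻ s in Set.Ioo a y, (∫⁻ σ in Set.Ioo s b, w σ) ^ (-(p / (p - r))) * w s *
                  Vr r v s y ^ (p * r / (p - r))) ^ ((p - r) * q / ((p - q) * r))))
        (volume.restrict (Set.Ioo a x))) ^ ((p - q) / (p * q))

def C₇ (a b r p q : ℝ) (u v w : ℝ → ℝ≥0∞) : ℝ≥0∞ :=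
  (∫⁻ x in Set.Ioo a b, w x *
      essSup (fun y => (∫⁻ s in Set.Ioo y b, w s) ^ (-(p / (p - q))) *
          essSup (fun t => (∫⁻ s in Set.Ioo t x, u s) ^ (p / (p - q)) *
              Vr r v y t ^ (p * q / (p - q)))
            (volume.restrict (Set.Ioo y x)))
        (volume.restrict (Set.Ioo a x))) ^ ((p - q) / (p * q))


lemma measure_le_of_forall_inter_Ioi_le {μ : Measure ℝ} (hμ : μ ≪ volume) {S : Set ℝ}
    (hS : BddBelow S) {M : ℝ≥0∞}
    (h : ∀ᵐ x ∂(volume : Measure ℝ), x ∈ S → μ (S ∩ Ioi x) ≤ M) : μ S ≤ M := by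
  set S' := S ∩ {x | x ∈ S → μ (S ∩ Ioi x) ≤ M} with hS'
  have hSS' : μ S ≤ μ S' := by
    refine measure_mono_ae ?_
    filter_upwards [hμ.ae_le h] with x hx hxS
    exact ⟨hxS, hx⟩
  refine hSS'.trans ?_
  rcases S'.eq_empty_or_nonempty with he | hne
  · simp [he]
  have hbdd : BddBelow S' := hS.mono inter_subset_left
  obtain ⟨x, hanti, hlim, hmem⟩ := exists_seq_tendsto_sInf hne hbdd
  have hcov : S' ⊆ {sInf S'} ∪ ⋃ n, S ∩ Ioi (x n) := by
    intro s hs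
    rcases (csInf_le hbdd hs).eq_or_lt with h0 | h0
    · left; exact h0.symm
    · right
      obtain ⟨n, hn⟩ := ((tendsto_order.1 hlim).2 s h0).exists
      exact mem_iUnion.2 ⟨n, hs.1, hn⟩
  have hmono : Monotone fun n => S ∩ Ioi (x n) := fun m n hmn =>
    inter_subset_inter_right _ (Ioi_subset_Ioi (hanti hmn))
  calc μ S' ≤ μ {sInf S'} + μ (⋃ n, S ∩ Ioi (x n)) :=
        (measure_mono hcov).trans (measure_union_le _ _)
    _ = ⨆ n, μ (S ∩ Ioi (x n)) := by
        rw [hμ Real.volume_singleton, zero_add, hmono.measure_iUnion]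
    _ ≤ M := iSup_le fun n => (hmem n).2 (hmem n).1

lemma measure_le_of_forall_inter_Iio_le {μ : Measure ℝ} (hμ : μ ≪ volume) {S : Set ℝ}
    (hS : BddAbove S) {M : ℝ≥0∞} (h : ∀ x ∈ S, μ (S ∩ Iio x) ≤ M) : μ S ≤ M := by
  rcases S.eq_empty_or_nonempty with he | hne
  · simp [he]
  obtain ⟨x, hmon, hlim, hmem⟩ := exists_seq_tendsto_sSup hne hS
  have hcov : S ⊆ {sSup S} ∪ ⋃ n, S ∩ Iio (x n) := by
    intro s hs
    rcases (le_csSup hS hs).eq_or_lt with h0 | h0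
    · left; exact h0
    · right
      obtain ⟨n, hn⟩ := ((tendsto_order.1 hlim).1 s h0).exists
      exact mem_iUnion.2 ⟨n, hs, hn⟩
  have hmono : Monotone fun n => S ∩ Iio (x n) := fun m n hmn =>
    inter_subset_inter_right _ (Iio_subset_Iio (hmon hmn))
  calc μ S ≤ μ {sSup S} + μ (⋃ n, S ∩ Iio (x n)) :=
        (measure_mono hcov).trans (measure_union_le _ _)
    _ = ⨆ n, μ (S ∩ Iio (x n)) := by
        rw [hμ Real.volume_singleton, zero_add, hmono.measure_iUnion]
    _ ≤ M := iSup_le fun n => h _ (hmem n)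

lemma rpow_neg_half_le_tsum {T N : ℝ≥0∞} (hT0 : T ≠ 0) (hT : T ≠ ∞) (hN : N ≤ T) :
    N ^ (-(1 / 2) : ℝ) ≤
      ∑' j : ℕ, {x : ℝ≥0∞ | x ≤ T * (4⁻¹) ^ j}.indicator
        (fun _ => T ^ (-(1 / 2) : ℝ) * 2 ^ (j + 1)) N := by
  have h42 : (4 : ℝ≥0∞) = 2 ^ (2 : ℝ) := by norm_num
  have hscale : ∀ j : ℕ, (T * (4⁻¹) ^ j) ^ (-(1 / 2) : ℝ) = T ^ (-(1 / 2) : ℝ) * 2 ^ j := by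
    intro j
    rw [ENNReal.mul_rpow_of_ne_top hT (by simp), h42, ← ENNReal.rpow_neg, ← ENNReal.rpow_natCast,
      ← ENNReal.rpow_natCast, ← ENNReal.rpow_mul, ← ENNReal.rpow_mul]
    congr 2; ring
  rcases eq_or_ne N 0 with rfl | hN0
  · have : ∀ j : ℕ, T ^ (-(1 / 2) : ℝ) ≤ {x : ℝ≥0∞ | x ≤ T * (4⁻¹) ^ j}.indicator
        (fun _ => T ^ (-(1 / 2) : ℝ) * 2 ^ (j + 1)) 0 := by
      intro j
      rw [indicator_of_mem (by simp)]
      exact le_mul_of_one_le_right' (one_le_pow₀ (by norm_num))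
    refine le_trans ?_ (ENNReal.tsum_le_tsum this)
    rw [ENNReal.tsum_const_eq_top_of_ne_zero]
    · exact le_top
    · simp [ENNReal.rpow_eq_zero_iff, hT0, hT]
  · have hlim : Filter.Tendsto (fun j : ℕ => T * (4⁻¹ : ℝ≥0∞) ^ j) Filter.atTop (nhds 0) := by
      have := ENNReal.Tendsto.const_mul (a := T)
        (ENNReal.tendsto_pow_atTop_nhds_zero_of_lt_one (r := 4⁻¹) (by norm_num)) (Or.inr hT)
      simpa using this
    have hex : ∃ j : ℕ, T * (4⁻¹ : ℝ≥0∞) ^ j < N :=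
      ((tendsto_order.1 hlim).2 N (pos_iff_ne_zero.2 hN0)).exists
    classical
    have hspec := Nat.find_spec hex
    have hpos : Nat.find hex ≠ 0 := by
      intro h0; rw [h0] at hspec; simp at hspec; exact absurd hN (not_le.2 hspec)
    obtain ⟨j, hj⟩ := Nat.exists_eq_succ_of_ne_zero hpos
    have hnot : N ≤ T * (4⁻¹ : ℝ≥0∞) ^ j := not_lt.1 (Nat.find_min hex (by omega))
    rw [hj] at hspec
    refine le_trans ?_ (ENNReal.le_tsum j)
    rw [indicator_of_mem (by exact hnot), ← hscale]
    rw [ENNReal.rpow_neg, ENNReal.rpow_neg]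
    exact ENNReal.inv_le_inv.2 (ENNReal.rpow_le_rpow hspec.le (by norm_num))

lemma lintegral_rpow_neg_half_le {ν : Measure ℝ} {N : ℝ → ℝ≥0∞} (hN : Measurable N) {T : ℝ≥0∞}
    (hT : T ≠ ∞) (hNT : ∀ᵐ s ∂ν, N s ≤ T) (h : ∀ l, ν {s | N s ≤ l} ≤ l) :
    ∫⁻ s, N s ^ (-(1 / 2) : ℝ) ∂ν ≤ 4 * T ^ (1 / 2 : ℝ) := by
  rcases eq_or_ne T 0 with rfl | hT0
  · have h0 : ν {s | N s ≤ 0} = 0 := le_antisymm (h 0) zero_le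
    have : ν = 0 := by
      rw [← Measure.measure_univ_eq_zero, ← nonpos_iff_eq_zero, ← h0]
      exact measure_mono_ae (hNT.mono fun s hs _ => hs)
    simp [this]
  have hms : ∀ l : ℝ≥0∞, MeasurableSet {s | N s ≤ l} := fun l =>
    measurableSet_le hN measurable_const
  calc ∫⁻ s, N s ^ (-(1 / 2) : ℝ) ∂ν
      ≤ ∫⁻ s, ∑' j : ℕ, {s | N s ≤ T * (4⁻¹) ^ j}.indicator
        (fun _ => T ^ (-(1 / 2) : ℝ) * 2 ^ (j + 1)) s ∂ν :=
        lintegral_mono_ae (hNT.mono fun s hs => rpow_neg_half_le_tsum hT0 hT hs)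
    _ = ∑' j : ℕ, T ^ (-(1 / 2) : ℝ) * 2 ^ (j + 1) * ν {s | N s ≤ T * (4⁻¹) ^ j} := by
        rw [lintegral_tsum]
        · refine tsum_congr fun j => ?_
          rw [lintegral_indicator_const (hms _)]
        · intro j
          exact (measurable_const.indicator (hms _)).aemeasurable
    _ ≤ ∑' j : ℕ, (2 * T ^ (1 / 2 : ℝ)) * (2⁻¹) ^ j := by
        refine ENNReal.tsum_le_tsum fun j => ?_
        refine (mul_le_mul_right (h _) _).trans (le_of_eq ?_)
        have e1 : T ^ (1 / 2 : ℝ) = T ^ (-(1 / 2) : ℝ) * T := by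
          nth_rewrite 3 [← ENNReal.rpow_one T]
          rw [← ENNReal.rpow_add _ _ hT0 hT]; norm_num
        have e2 : (2 : ℝ≥0∞) ^ j * (4⁻¹) ^ j = (2⁻¹) ^ j := by
          rw [← mul_pow]; congr 1
          rw [show (4 : ℝ≥0∞) = 2 * 2 by norm_num, ENNReal.mul_inv (by simp) (by simp),
            ← mul_assoc, ENNReal.mul_inv_cancel (by simp) (by simp), one_mul]
        rw [e1, ← e2, pow_succ]; ring
    _ = 4 * T ^ (1 / 2 : ℝ) := by
        rw [ENNReal.tsum_mul_left, ENNReal.tsum_geometric, ENNReal.one_sub_inv_two, inv_inv]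
        ring

/-- Minkowski's integral inequality. -/
lemma lintegral_lintegral_rpow_le {α β : Type*} [MeasurableSpace α] [MeasurableSpace β]
    {l : Measure α} {μ : Measure β} [SFinite l] [SFinite μ] {K : α → β → ℝ≥0∞}
    (hK : Measurable (Function.uncurry K)) {q : ℝ} (hq : 1 ≤ q) :
    (∫⁻ t, (∫⁻ s, K s t ∂l) ^ q ∂μ) ^ (1 / q) ≤ ∫⁻ s, (∫⁻ t, K s t ^ q ∂μ) ^ (1 / q) ∂l := by
  have hq0 : 0 < q := by linarith
  have hK1 : ∀ s, Measurable (K s) := fun s => hK.comp (measurable_const.prodMk measurable_id)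
  have hK2 : ∀ t, Measurable (fun s => K s t) :=
    fun t => hK.comp (measurable_id.prodMk measurable_const)
  have hKs : Measurable fun z : β × α => K z.2 z.1 := hK.comp measurable_swap
  set N : α → ℝ≥0∞ := fun s => (∫⁻ t, K s t ^ q ∂μ) ^ (1 / q) with hN
  have hNm : Measurable N := by
    refine Measurable.pow_const ?_ _
    exact Measurable.lintegral_prod_right' (f := fun z : α × β => K z.1 z.2 ^ q) (hK.pow_const q)
  rcases eq_or_ne (∫⁻ s, N s ∂l) ∞ with hM | hM
  · rw [hM]; exact le_top
  have hNtop : ∀ᵐ s ∂l, N s ≠ ∞ := (ae_lt_top hNm hM).mono fun s h => h.ne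
  have hNq : ∀ s, N s ^ q = ∫⁻ t, K s t ^ q ∂μ := by
    intro s; simp only [hN]; rw [← ENNReal.rpow_mul, one_div_mul_cancel hq0.ne', ENNReal.rpow_one]
  have hzero : ∀ᵐ t ∂μ, ∀ᵐ s ∂l, N s = 0 → K s t = 0 := by
    have hms : MeasurableSet {z : α × β | N z.1 = 0 → K z.1 z.2 = 0} := by
      have : {z : α × β | N z.1 = 0 → K z.1 z.2 = 0} =
          {z | N z.1 = 0}ᶜ ∪ {z | K z.1 z.2 = 0} := by
        ext z; simp [imp_iff_not_or]
      rw [this]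
      exact ((hNm.comp measurable_fst) (measurableSet_singleton 0)).compl.union
        (hK (measurableSet_singleton 0))
    rw [← Measure.ae_ae_comm hms]
    refine Filter.Eventually.of_forall fun s => ?_
    by_cases h0 : N s = 0
    · have h1 : ∫⁻ t, K s t ^ q ∂μ = 0 := by rw [← hNq, h0, ENNReal.zero_rpow_of_pos hq0]
      filter_upwards [ae_eq_zero_of_lintegral_rpow_eq_zero hq0.le (hK1 s).aemeasurable h1]
        with t ht _ using ht
    · exact Filter.Eventually.of_forall fun t h => absurd h h0
  have hpt : ∀ᵐ t ∂μ, (∫⁻ s, K s t ∂l) ^ q ≤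
      (∫⁻ s, K s t ^ q * N s ^ (1 - q) ∂l) * (∫⁻ s, N s ∂l) ^ (q - 1) := by
    filter_upwards [hzero] with t ht
    have hhold := ENNReal.lintegral_mul_norm_pow_le (μ := l)
      (f := fun s => K s t ^ q * N s ^ (1 - q)) (g := N)
      (((hK2 t).pow_const q).mul (hNm.pow_const _)).aemeasurable hNm.aemeasurable
      (p := 1 / q) (q := 1 - 1 / q) (by positivity)
      (by rw [sub_nonneg, div_le_one hq0]; exact hq) (by ring)
    have hle : ∫⁻ s, K s t ∂l ≤
        ∫⁻ s, (K s t ^ q * N s ^ (1 - q)) ^ (1 / q) * N s ^ (1 - 1 / q) ∂l := by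
      refine lintegral_mono_ae ?_
      filter_upwards [ht, hNtop] with s h0 h1
      rcases eq_or_ne (N s) 0 with hz | hz
      · rw [h0 hz]; exact zero_le
      · rw [ENNReal.mul_rpow_of_nonneg _ _ (by positivity : 0 ≤ 1 / q), ← ENNReal.rpow_mul,
          ← ENNReal.rpow_mul, mul_one_div_cancel hq0.ne', ENNReal.rpow_one, mul_assoc,
          ← ENNReal.rpow_add _ _ hz h1,
          show (1 - q) * (1 / q) + (1 - 1 / q) = 0 by field_simp; ring, ENNReal.rpow_zero, mul_one]
    calc (∫⁻ s, K s t ∂l) ^ q ≤ _ := ENNReal.rpow_le_rpow (hle.trans hhold) hq0.le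
      _ = _ := by
        rw [ENNReal.mul_rpow_of_nonneg _ _ hq0.le, ← ENNReal.rpow_mul, ← ENNReal.rpow_mul,
          one_div_mul_cancel hq0.ne', ENNReal.rpow_one,
          show (1 - 1 / q) * q = q - 1 by field_simp]
  have hmain : ∫⁻ t, (∫⁻ s, K s t ∂l) ^ q ∂μ ≤ (∫⁻ s, N s ∂l) ^ q := by
    calc ∫⁻ t, (∫⁻ s, K s t ∂l) ^ q ∂μ
        ≤ ∫⁻ t, (∫⁻ s, K s t ^ q * N s ^ (1 - q) ∂l) * (∫⁻ s, N s ∂l) ^ (q - 1) ∂μ :=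
          lintegral_mono_ae hpt
      _ = (∫⁻ t, ∫⁻ s, K s t ^ q * N s ^ (1 - q) ∂l ∂μ) * (∫⁻ s, N s ∂l) ^ (q - 1) := by
          refine lintegral_mul_const' _ _ ?_
          exact ENNReal.rpow_ne_top_of_nonneg (by linarith) hM
      _ = (∫⁻ s, ∫⁻ t, K s t ^ q * N s ^ (1 - q) ∂μ ∂l) * (∫⁻ s, N s ∂l) ^ (q - 1) := by
          rw [lintegral_lintegral_swap]
          exact ((hKs.pow_const q).mul ((hNm.comp measurable_snd).pow_const _)).aemeasurable
      _ ≤ (∫⁻ s, N s ∂l) * (∫⁻ s, N s ∂l) ^ (q - 1) := by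
          refine mul_le_mul_left (lintegral_mono_ae ?_) _
          filter_upwards [hNtop] with s h1
          rw [lintegral_mul_const _ ((hK1 s).pow_const q), ← hNq]
          rcases eq_or_ne (N s) 0 with hz | hz
          · rw [hz, ENNReal.zero_rpow_of_pos hq0, zero_mul]
          · rw [← ENNReal.rpow_add _ _ hz h1]; simp
      _ = (∫⁻ s, N s ∂l) ^ q := by
          nth_rewrite 1 [← ENNReal.rpow_one (∫⁻ s, N s ∂l)]
          rw [← ENNReal.rpow_add_of_nonneg _ _ zero_le_one (by linarith)]
          congr 1; ring
  calc _ ≤ ((∫⁻ s, N s ∂l) ^ q) ^ (1 / q) := ENNReal.rpow_le_rpow hmain (by positivity)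
    _ = _ := by rw [← ENNReal.rpow_mul, mul_one_div_cancel hq0.ne', ENNReal.rpow_one]

lemma tsum_rpow_le_rpow_tsum {ι : Type*} (y : ι → ℝ≥0∞) {s : ℝ} (hs : 1 ≤ s) :
    ∑' k, y k ^ s ≤ (∑' k, y k) ^ s := by
  have e : ∀ z : ℝ≥0∞, z ^ s = z * z ^ (s - 1) := by
    intro z
    nth_rewrite 2 [← ENNReal.rpow_one z]
    rw [← ENNReal.rpow_add_of_nonneg _ _ zero_le_one (by linarith)]
    congr 1; ring
  rw [e (∑' k, y k), ← ENNReal.tsum_mul_right]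
  refine ENNReal.tsum_le_tsum fun k => ?_
  rw [e]
  exact mul_le_mul_right (ENNReal.rpow_le_rpow (ENNReal.le_tsum k) (by linarith)) _

lemma lintegral_measure_Iio_rpow_le {μ : Measure ℝ} (hμ : μ ≪ volume) {t : ℝ}
    (ht : μ (Iio t) ≠ ∞) :
    ∫⁻ s in Iio t, μ (Iio s) ^ (-(1 / 2) : ℝ) ∂μ ≤ 4 * μ (Iio t) ^ (1 / 2 : ℝ) := by
  have hm : Monotone fun s => μ (Iio s) := fun x y h => measure_mono (Iio_subset_Iio h)
  refine lintegral_rpow_neg_half_le hm.measurable ht ?_ fun l => ?_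
  · filter_upwards [ae_restrict_mem measurableSet_Iio] with s hs using hm (le_of_lt hs)
  · rw [Measure.restrict_apply' measurableSet_Iio]
    refine measure_le_of_forall_inter_Iio_le hμ ⟨t, fun s hs => le_of_lt hs.2⟩ fun x hx => ?_
    exact (measure_mono inter_subset_right).trans hx.1

lemma lintegral_measure_Ioi_rpow_le {μ : Measure ℝ} (hμ : μ ≪ volume) {t : ℝ}
    (ht : μ (Ioi t) ≠ ∞) :
    ∫⁻ s in Ioi t, μ (Ioi s) ^ (-(1 / 2) : ℝ) ∂μ ≤ 4 * μ (Ioi t) ^ (1 / 2 : ℝ) := by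
  have hm : Antitone fun s => μ (Ioi s) := fun x y h => measure_mono (Ioi_subset_Ioi h)
  refine lintegral_rpow_neg_half_le hm.measurable ht ?_ fun l => ?_
  · filter_upwards [ae_restrict_mem measurableSet_Ioi] with s hs using hm (le_of_lt hs)
  · rw [Measure.restrict_apply' measurableSet_Ioi]
    refine measure_le_of_forall_inter_Ioi_le hμ ⟨t, fun s hs => le_of_lt hs.2⟩
      (Filter.Eventually.of_forall fun x hx => ?_)
    exact (measure_mono inter_subset_right).trans hx.1

lemma lintegral_setLIntegral_Iio_rpow_le {l μ : Measure ℝ} [SFinite l] [SFinite μ] {g : ℝ → ℝ≥0∞}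
    (hg : Measurable g) {q : ℝ} (hq : 1 ≤ q) :
    (∫⁻ t, (∫⁻ s in Iio t, g s ∂l) ^ q ∂μ) ^ (1 / q) ≤ ∫⁻ s, g s * μ (Ioi s) ^ (1 / q) ∂l := by
  have hq0 : 0 < q := by linarith
  have hK : Measurable (Function.uncurry fun s t : ℝ => (Iio t).indicator g s) := by
    have : (Function.uncurry fun s t : ℝ => (Iio t).indicator g s) =
        {z : ℝ × ℝ | z.1 < z.2}.indicator (fun z => g z.1) := by
      ext z; simp [Function.uncurry, indicator]
    rw [this]
    exact (hg.comp measurable_fst).indicator (measurableSet_lt measurable_fst measurable_snd)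
  have := lintegral_lintegral_rpow_le (l := l) (μ := μ) hK hq
  simp_rw [lintegral_indicator measurableSet_Iio] at this
  refine this.trans (le_of_eq (lintegral_congr fun s => ?_))
  have e : ∀ t : ℝ, (Iio t).indicator g s ^ q = (Ioi s).indicator (fun _ => g s ^ q) t := by
    intro t
    by_cases h : s < t
    · rw [indicator_of_mem (by exact h), indicator_of_mem (by exact h)]
    · rw [indicator_of_notMem (by exact h), indicator_of_notMem (by exact h),
        ENNReal.zero_rpow_of_pos hq0]
  simp_rw [e]
  rw [lintegral_indicator_const measurableSet_Ioi,
    ENNReal.mul_rpow_of_nonneg _ _ (by positivity : 0 ≤ 1 / q), ← ENNReal.rpow_mul,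
    mul_one_div_cancel hq0.ne', ENNReal.rpow_one]

/-- A weighted Hardy-type inequality with exponent `r < 1`: under the Muckenhoupt-type condition
on `μ` and `φ`, the operator `f ↦ (∫_{s < t} f ^ r φ ^ (1 - r))^{1/r}` maps `L¹` to `L^q`. -/
lemma hardy_rpow_le {l μ : Measure ℝ} [SFinite l] [SFinite μ] (hl : l ≪ volume) (hμ : μ ≪ volume)
    {φ f : ℝ → ℝ≥0∞} (hφ : Measurable φ) (hf : Measurable f) {r q : ℝ} (hr0 : 0 < r) (hr1 : r < 1)
    (hq : 1 ≤ q) {J : Set ℝ} (hJ : BddAbove J) (hJμ : ∀ᵐ t ∂μ, t ∈ J) (hJl : ∀ᵐ t ∂l, t ∈ J)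
    (hU : ∀ t ∈ J, μ (Ioi t) ≠ 0) (hφ0 : ∀ᵐ s ∂l, φ s ≠ 0) {B : ℝ≥0∞} (hB : B ≠ ∞)
    (h : ∀ t ∈ J, μ (Ioi t) ^ (1 / q) * l.withDensity φ (Iio t) ^ ((1 - r) / r) ≤ B) :
    (∫⁻ t, (∫⁻ s in Iio t, f s ^ r * φ s ^ (1 - r) ∂l) ^ (q / r) ∂μ) ^ (1 / q) ≤
      4 ^ ((1 - r) / r) * 4 ^ (1 / q) * B * ∫⁻ s, f s ∂l := by
  have hq0 : 0 < q := by linarith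
  have hr1' : 0 < 1 - r := by linarith
  set ν := l.withDensity φ with hν
  have hνv : ν ≪ volume := (withDensity_absolutelyContinuous l φ).trans hl
  set Φ : ℝ → ℝ≥0∞ := fun t => ν (Iio t) with hΦ
  set U : ℝ → ℝ≥0∞ := fun t => μ (Ioi t) with hUdef
  have hΦmono : Monotone Φ := fun x y h => measure_mono (Iio_subset_Iio h)
  have hΦm : Measurable Φ := hΦmono.measurable
  have hUm : Measurable U :=
    Antitone.measurable fun x y h => measure_mono (Ioi_subset_Ioi h)
  have hΦfin : ∀ t ∈ J, Φ t ≠ ∞ := by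
    intro t ht htop
    have := h t ht
    change U t ^ (1 / q) * Φ t ^ ((1 - r) / r) ≤ B at this
    rw [htop, ENNReal.top_rpow_of_pos (by positivity), ENNReal.mul_top, top_le_iff] at this
    · exact hB this
    · intro h0
      rw [ENNReal.rpow_eq_zero_iff_of_pos (by positivity)] at h0
      exact hU t ht h0
  have hUfin : ∀ t ∈ J, Φ t ≠ 0 → U t ≠ ∞ := by
    intro t ht h0 htop
    have := h t ht
    change U t ^ (1 / q) * Φ t ^ ((1 - r) / r) ≤ B at this
    rw [htop, ENNReal.top_rpow_of_pos (by positivity), ENNReal.top_mul, top_le_iff] at this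
    · exact hB this
    · intro h1
      rw [ENNReal.rpow_eq_zero_iff_of_pos (by positivity)] at h1
      exact h0 h1
  have hΦpos : ∀ᵐ s ∂l, Φ s ≠ 0 := by
    have h0 : ν {s | s ∈ J ∧ Φ s = 0} ≤ 0 := by
      refine measure_le_of_forall_inter_Iio_le hνv (hJ.mono fun s hs => hs.1) fun x hx => ?_
      exact (measure_mono inter_subset_right).trans hx.2.le
    have h1 : ∀ᵐ s ∂ν, ¬ (s ∈ J ∧ Φ s = 0) := by
      rw [ae_iff]; simpa using h0
    rw [hν, ae_withDensity_iff hφ] at h1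
    filter_upwards [h1, hφ0, hJl] with s h1 h2 h3 h4
    exact h1 h2 ⟨h3, h4⟩
  set β : ℝ := (1 - r) / (2 * r) with hβ
  set e : ℝ := (1 - r) * q / r with he
  have he0 : 0 < e := by positivity
  have hhold : ∀ t ∈ J, (∫⁻ s in Iio t, f s ^ r * φ s ^ (1 - r) ∂l) ^ (q / r) ≤
      (4 ^ e * B ^ (q / 2)) *
        (U t ^ (-(1 / 2) : ℝ) * (∫⁻ s in Iio t, f s * Φ s ^ β ∂l) ^ q) := by
    intro t ht
    have h1 : ∫⁻ s in Iio t, f s ^ r * φ s ^ (1 - r) ∂l ≤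
        ∫⁻ s in Iio t, (f s * Φ s ^ β) ^ r * (φ s * Φ s ^ (-(1 / 2) : ℝ)) ^ (1 - r) ∂l := by
      refine lintegral_mono_ae ?_
      filter_upwards [ae_restrict_of_ae hΦpos, ae_restrict_mem measurableSet_Iio] with s h0 hs
      have h2 : Φ s ≠ ∞ := ne_top_of_le_ne_top (hΦfin t ht) (hΦmono (le_of_lt hs))
      rw [ENNReal.mul_rpow_of_nonneg _ _ hr0.le, ENNReal.mul_rpow_of_nonneg _ _ hr1'.le,
        ← ENNReal.rpow_mul, ← ENNReal.rpow_mul, mul_mul_mul_comm, ← ENNReal.rpow_add _ _ h0 h2,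
        show β * r + -(1 / 2) * (1 - r) = 0 by rw [hβ]; field_simp; ring, ENNReal.rpow_zero,
        mul_one]
    have h2 : ∫⁻ s in Iio t, φ s * Φ s ^ (-(1 / 2) : ℝ) ∂l ≤ 4 * Φ t ^ (1 / 2 : ℝ) := by
      refine le_trans (le_of_eq ?_) (lintegral_measure_Iio_rpow_le hνv (hΦfin t ht))
      rw [hν, setLIntegral_withDensity_eq_setLIntegral_mul _ hφ (hΦm.pow_const _)
        measurableSet_Iio]
      rfl
    have h3 := h1.trans (ENNReal.lintegral_mul_norm_pow_le (μ := l.restrict (Iio t))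
      (f := fun s => f s * Φ s ^ β) (g := fun s => φ s * Φ s ^ (-(1 / 2) : ℝ))
      (hf.mul (hΦm.pow_const _)).aemeasurable (hφ.mul (hΦm.pow_const _)).aemeasurable
      hr0.le hr1'.le (by ring))
    have h4 : Φ t ^ (e / 2) ≤ B ^ (q / 2) * U t ^ (-(1 / 2) : ℝ) := by
      have h5 := ENNReal.rpow_le_rpow (h t ht) (by positivity : 0 ≤ q / 2)
      change (U t ^ (1 / q) * Φ t ^ ((1 - r) / r)) ^ (q / 2) ≤ _ at h5
      rw [ENNReal.mul_rpow_of_nonneg _ _ (by positivity : 0 ≤ q / 2), ← ENNReal.rpow_mul,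
        ← ENNReal.rpow_mul, show 1 / q * (q / 2) = 1 / 2 by field_simp,
        show (1 - r) / r * (q / 2) = e / 2 by rw [he]; ring, mul_comm] at h5
      rw [ENNReal.rpow_neg, ← div_eq_mul_inv, ENNReal.le_div_iff_mul_le]
      · exact h5
      · left
        intro h0
        rw [ENNReal.rpow_eq_zero_iff_of_pos (by positivity)] at h0
        exact hU t ht h0
      · right; exact ENNReal.rpow_ne_top_of_nonneg (by positivity) hB
    calc (∫⁻ s in Iio t, f s ^ r * φ s ^ (1 - r) ∂l) ^ (q / r)
        ≤ ((∫⁻ s in Iio t, f s * Φ s ^ β ∂l) ^ r *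
            (4 * Φ t ^ (1 / 2 : ℝ)) ^ (1 - r)) ^ (q / r) := by
          refine ENNReal.rpow_le_rpow (h3.trans ?_) (by positivity)
          exact mul_le_mul_right (ENNReal.rpow_le_rpow h2 hr1'.le) _
      _ = (∫⁻ s in Iio t, f s * Φ s ^ β ∂l) ^ q * (4 ^ e * Φ t ^ (e / 2)) := by
          rw [ENNReal.mul_rpow_of_nonneg _ _ (by positivity : 0 ≤ q / r), ← ENNReal.rpow_mul,
            ← ENNReal.rpow_mul, ENNReal.mul_rpow_of_nonneg _ _ (by positivity), ← ENNReal.rpow_mul,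
            show r * (q / r) = q by field_simp, show (1 - r) * (q / r) = e by rw [he]; ring,
            show 1 / 2 * e = e / 2 by ring]
      _ ≤ (∫⁻ s in Iio t, f s * Φ s ^ β ∂l) ^ q *
            (4 ^ e * (B ^ (q / 2) * U t ^ (-(1 / 2) : ℝ))) := by gcongr
      _ = _ := by ring
  have hUw : ∀ s, Φ s ≠ 0 → s ∈ J →
      μ.withDensity (fun t => U t ^ (-(1 / 2) : ℝ)) (Ioi s) ≤ 4 * U s ^ (1 / 2 : ℝ) := by
    intro s h0 hs
    rw [withDensity_apply _ measurableSet_Ioi]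
    exact lintegral_measure_Ioi_rpow_le hμ (hUfin s hs h0)
  have hGm : Measurable fun s => f s * Φ s ^ β := hf.mul (hΦm.pow_const _)
  have hInner : Measurable fun t => ∫⁻ s in Iio t, f s * Φ s ^ β ∂l :=
    Monotone.measurable fun x y hxy => lintegral_mono_set (Iio_subset_Iio hxy)
  have hcne : (4 ^ e * B ^ (q / 2) : ℝ≥0∞) ≠ ∞ :=
    ENNReal.mul_ne_top (ENNReal.rpow_ne_top_of_nonneg he0.le (by simp))
      (ENNReal.rpow_ne_top_of_nonneg (by positivity) hB)
  calc (∫⁻ t, (∫⁻ s in Iio t, f s ^ r * φ s ^ (1 - r) ∂l) ^ (q / r) ∂μ) ^ (1 / q)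
      ≤ (∫⁻ t, (4 ^ e * B ^ (q / 2)) *
        (U t ^ (-(1 / 2) : ℝ) * (∫⁻ s in Iio t, f s * Φ s ^ β ∂l) ^ q) ∂μ) ^ (1 / q) :=
        ENNReal.rpow_le_rpow (lintegral_mono_ae (hJμ.mono hhold)) (by positivity)
    _ = (4 ^ e * B ^ (q / 2)) ^ (1 / q) * (∫⁻ t, (∫⁻ s in Iio t, f s * Φ s ^ β ∂l) ^ q
          ∂(μ.withDensity fun t => U t ^ (-(1 / 2) : ℝ))) ^ (1 / q) := by
        rw [lintegral_const_mul' _ _ hcne, ENNReal.mul_rpow_of_nonneg _ _ (by positivity),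
          lintegral_withDensity_eq_lintegral_mul _ (hUm.pow_const _) (hInner.pow_const _)]
        rfl
    _ ≤ (4 ^ e * B ^ (q / 2)) ^ (1 / q) * ∫⁻ s, f s * Φ s ^ β *
          μ.withDensity (fun t => U t ^ (-(1 / 2) : ℝ)) (Ioi s) ^ (1 / q) ∂l :=
        mul_le_mul_right (lintegral_setLIntegral_Iio_rpow_le hGm hq) _
    _ ≤ (4 ^ e * B ^ (q / 2)) ^ (1 / q) * ∫⁻ s, 4 ^ (1 / q) * B ^ (1 / 2 : ℝ) * f s ∂l := by
        refine mul_le_mul_right (lintegral_mono_ae ?_) _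
        filter_upwards [hΦpos, hJl] with s h0 hs
        have h6 := ENNReal.rpow_le_rpow (h s hs) (by norm_num : (0 : ℝ) ≤ 1 / 2)
        change (U s ^ (1 / q) * Φ s ^ ((1 - r) / r)) ^ (1 / 2 : ℝ) ≤ _ at h6
        rw [ENNReal.mul_rpow_of_nonneg _ _ (by norm_num : (0 : ℝ) ≤ 1 / 2), ← ENNReal.rpow_mul,
          ← ENNReal.rpow_mul, show (1 - r) / r * (1 / 2) = β by rw [hβ]; field_simp] at h6
        calc f s * Φ s ^ β * μ.withDensity (fun t => U t ^ (-(1 / 2) : ℝ)) (Ioi s) ^ (1 / q)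
            ≤ f s * Φ s ^ β * (4 * U s ^ (1 / 2 : ℝ)) ^ (1 / q) :=
              mul_le_mul_right (ENNReal.rpow_le_rpow (hUw s h0 hs) (by positivity)) _
          _ = 4 ^ (1 / q) * (U s ^ (1 / q * (1 / 2)) * Φ s ^ β) * f s := by
              rw [ENNReal.mul_rpow_of_nonneg _ _ (by positivity), ← ENNReal.rpow_mul,
                mul_comm (1 / q) (1 / 2)]
              ring
          _ ≤ _ := by gcongr
    _ = _ := by
        rw [lintegral_const_mul _ hf, ENNReal.mul_rpow_of_nonneg _ _ (by positivity : 0 ≤ 1 / q),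
          ← ENNReal.rpow_mul, ← ENNReal.rpow_mul, show e * (1 / q) = (1 - r) / r by
            rw [he]; field_simp, show q / 2 * (1 / q) = 1 / 2 by field_simp]
        have hBB : B ^ (1 / 2 : ℝ) * B ^ (1 / 2 : ℝ) = B := by
          rw [← ENNReal.rpow_add_of_nonneg _ _ (by norm_num) (by norm_num)]; norm_num
        calc _ = 4 ^ ((1 - r) / r) * 4 ^ (1 / q) * (B ^ (1 / 2 : ℝ) * B ^ (1 / 2 : ℝ)) *
              ∫⁻ s, f s ∂l := by ring
          _ = _ := by rw [hBB]

lemma lintegral_tsum_rpow_le {β : Type*} [MeasurableSpace β] {μ : Measure β} [SFinite μ]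
    {h : ℤ → β → ℝ≥0∞} (hh : ∀ k, Measurable (h k)) {q : ℝ} (hq : 1 ≤ q) :
    (∫⁻ t, (∑' k, h k t) ^ q ∂μ) ^ (1 / q) ≤ ∑' k, (∫⁻ t, h k t ^ q ∂μ) ^ (1 / q) := by
  have hK : Measurable (Function.uncurry h) := measurable_from_prod_countable_right hh
  simpa only [lintegral_count] using
    lintegral_lintegral_rpow_le (l := (Measure.count : Measure ℤ)) (μ := μ) hK hq

/-- The dyadic level set `{t ∈ J | 2 ^ k ≤ μ (t, ∞) < 2 ^ (k + 1)}`. -/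
def dyadicLevel (μ : Measure ℝ) (J : Set ℝ) (k : ℤ) : Set ℝ :=
  {t | t ∈ J ∧ μ (Ioi t) ∈ Ico ((2 : ℝ≥0∞) ^ k) (2 ^ (k + 1))}

lemma antitone_measure_Ioi (μ : Measure ℝ) : Antitone fun t => μ (Ioi t) :=
  fun _ _ h => measure_mono (Ioi_subset_Ioi h)

lemma measurableSet_dyadicLevel (μ : Measure ℝ) {J : Set ℝ} (hJ : MeasurableSet J) (k : ℤ) :
    MeasurableSet (dyadicLevel μ J k) :=
  hJ.inter ((antitone_measure_Ioi μ).measurable measurableSet_Ico)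

lemma lt_of_mem_dyadicLevel {μ : Measure ℝ} {J : Set ℝ} {k m : ℤ} (hkm : k < m) {s t : ℝ}
    (hs : s ∈ dyadicLevel μ J m) (ht : t ∈ dyadicLevel μ J k) : s < t := by
  by_contra! hts
  have h1 : μ (Ioi s) ≤ μ (Ioi t) := antitone_measure_Ioi μ hts
  have h2 : (2 : ℝ≥0∞) ^ (k + 1) ≤ 2 ^ m := ENNReal.zpow_le_of_le (by norm_num) (by omega)
  exact absurd (h2.trans (hs.2.1.trans h1)) (not_le.2 ht.2.2)

lemma pairwise_disjoint_dyadicLevel (μ : Measure ℝ) (J : Set ℝ) :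
    Pairwise (Function.onFun Disjoint (dyadicLevel μ J)) := by
  intro k m hkm
  rw [Function.onFun, Set.disjoint_left]
  intro t hk hm
  rcases lt_or_gt_of_ne hkm with h | h
  · exact lt_irrefl _ (lt_of_mem_dyadicLevel h hm hk)
  · exact lt_irrefl _ (lt_of_mem_dyadicLevel h hk hm)

lemma iUnion_dyadicLevel {μ : Measure ℝ} {J : Set ℝ}
    (hJ : ∀ t ∈ J, μ (Ioi t) ≠ 0 ∧ μ (Ioi t) ≠ ∞) : ⋃ k, dyadicLevel μ J k = J := by
  ext t
  refine ⟨fun h => ?_, fun h => ?_⟩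
  · obtain ⟨k, hk⟩ := mem_iUnion.1 h
    exact hk.1
  · obtain ⟨k, hk⟩ := ENNReal.exists_mem_Ico_zpow (hJ t h).1 (hJ t h).2
      (by norm_num : (1 : ℝ≥0∞) < 2) (by norm_num)
    exact mem_iUnion.2 ⟨k, h, hk⟩

lemma le_measure_dyadicLevel {μ : Measure ℝ} (hμ : μ ≪ volume) {J : Set ℝ}
    (hJb : BddBelow J) (hJa : BddAbove J) (hμJ : ∀ᵐ t ∂μ, t ∈ J)
    (hJ : ∀ t ∈ J, μ (Ioi t) ≠ 0 ∧ μ (Ioi t) ≠ ∞) {k : ℤ} (hk : (dyadicLevel μ J k).Nonempty) :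
    (2 : ℝ≥0∞) ^ (k - 1) ≤ μ (dyadicLevel μ J (k - 1)) := by
  obtain ⟨x, hxJ, hx⟩ := hk
  set W : ℝ → ℝ≥0∞ := fun t => μ (Ioi t) with hW
  have hk0 : ∀ m : ℤ, (2 : ℝ≥0∞) ^ m ≠ ∞ := fun m =>
    ENNReal.zpow_ne_top (by norm_num) (by norm_num) m
  have hlow : μ {t | t ∈ J ∧ W t < 2 ^ (k - 1)} ≤ 2 ^ (k - 1) := by
    refine measure_le_of_forall_inter_Ioi_le hμ (hJb.mono fun t ht => ht.1)
      (Filter.Eventually.of_forall fun t ht => ?_)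
    exact (measure_mono inter_subset_right).trans ht.2.le
  have hup : μ {t | t ∈ J ∧ x < t ∧ 2 ^ k ≤ W t} ≤ W x - 2 ^ k := by
    refine measure_le_of_forall_inter_Iio_le hμ (hJa.mono fun t ht => ht.1) fun t ht => ?_
    refine ENNReal.le_sub_of_add_le_right (hk0 k) ?_
    calc μ ({t | t ∈ J ∧ x < t ∧ 2 ^ k ≤ W t} ∩ Iio t) + 2 ^ k
        ≤ μ (Ioc x t) + μ (Ioi t) :=
          add_le_add (measure_mono fun s hs => ⟨hs.1.2.1, le_of_lt hs.2⟩) ht.2.2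
      _ = μ (Ioi x) := by
          have hd : Disjoint (Ioc x t) (Ioi t) :=
            Set.disjoint_left.2 fun s h1 h2 => not_lt.2 h1.2 h2
          rw [← measure_union hd measurableSet_Ioi, Ioc_union_Ioi_eq_Ioi ht.2.1.le]
  have hcov : W x ≤ (W x - 2 ^ k) + (μ (dyadicLevel μ J (k - 1)) + 2 ^ (k - 1)) := by
    calc W x = μ (Ioi x) := rfl
      _ ≤ μ ({t | t ∈ J ∧ x < t ∧ 2 ^ k ≤ W t} ∪
            (dyadicLevel μ J (k - 1) ∪ {t | t ∈ J ∧ W t < 2 ^ (k - 1)})) := by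
          refine measure_mono_ae ?_
          filter_upwards [hμJ] with t htJ htx
          rcases le_or_gt (2 ^ k) (W t) with h | h
          · exact Or.inl ⟨htJ, htx, h⟩
          · rcases le_or_gt (2 ^ (k - 1)) (W t) with h' | h'
            · exact Or.inr (Or.inl ⟨htJ, h', by rwa [sub_add_cancel]⟩)
            · exact Or.inr (Or.inr ⟨htJ, h'⟩)
      _ ≤ _ := (measure_union_le _ _).trans (add_le_add hup
          ((measure_union_le _ _).trans (add_le_add le_rfl hlow)))
  have hsum : (2 : ℝ≥0∞) ^ k = 2 ^ (k - 1) + 2 ^ (k - 1) := by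
    rw [← two_mul]
    nth_rewrite 1 [show k = 1 + (k - 1) by ring]
    rw [ENNReal.zpow_add (by norm_num) (by norm_num), zpow_one]
  have h1 : (2 : ℝ≥0∞) ^ k ≤ μ (dyadicLevel μ J (k - 1)) + 2 ^ (k - 1) := by
    have h2 : W x - 2 ^ k + 2 ^ k = W x := tsub_add_cancel_of_le hx.1
    have h3 : W x - 2 ^ k ≠ ∞ := ENNReal.sub_ne_top (hJ x hxJ).2
    refine (ENNReal.add_le_add_iff_left h3).1 ?_
    rw [h2]; exact hcov
  rw [hsum] at h1
  exact (ENNReal.add_le_add_iff_right (hk0 _)).1 h1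

lemma tsum_dyadicLevel_le {μ l : Measure ℝ} (hμ : μ ≪ volume) {J : Set ℝ}
    (hJm : MeasurableSet J) (hJb : BddBelow J) (hJa : BddAbove J) (hμJ : ∀ᵐ t ∂μ, t ∈ J)
    (hJ : ∀ t ∈ J, μ (Ioi t) ≠ 0 ∧ μ (Ioi t) ≠ ∞) (f : ℝ → ℝ≥0∞) {p : ℝ} (hp : 0 < p) :
    ∑' k : ℤ, (2 : ℝ≥0∞) ^ (k - 1) * (∫⁻ s in dyadicLevel μ J k, f s ∂l) ^ p ≤
      ∫⁻ t, (∫⁻ s in Iio t, f s ∂l) ^ p ∂μ := by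
  have hE : ∀ k, MeasurableSet (dyadicLevel μ J k) := measurableSet_dyadicLevel μ hJm
  have hterm : ∀ k : ℤ, (2 : ℝ≥0∞) ^ (k - 1) * (∫⁻ s in dyadicLevel μ J k, f s ∂l) ^ p ≤
      ∫⁻ t in dyadicLevel μ J (k - 1), (∫⁻ s in Iio t, f s ∂l) ^ p ∂μ := by
    intro k
    rcases (dyadicLevel μ J k).eq_empty_or_nonempty with h | h
    · simp [h, ENNReal.zero_rpow_of_pos hp]
    calc (2 : ℝ≥0∞) ^ (k - 1) * (∫⁻ s in dyadicLevel μ J k, f s ∂l) ^ p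
        ≤ μ (dyadicLevel μ J (k - 1)) * (∫⁻ s in dyadicLevel μ J k, f s ∂l) ^ p :=
          mul_le_mul_left (le_measure_dyadicLevel hμ hJb hJa hμJ hJ h) _
      _ = ∫⁻ t in dyadicLevel μ J (k - 1), (∫⁻ s in dyadicLevel μ J k, f s ∂l) ^ p ∂μ := by
          rw [setLIntegral_const, mul_comm]
      _ ≤ _ := by
          refine setLIntegral_mono' (hE _) fun t ht => ENNReal.rpow_le_rpow ?_ hp.le
          exact lintegral_mono_set fun s hs => lt_of_mem_dyadicLevel (by omega) hs ht
  calc _ ≤ ∑' k : ℤ, ∫⁻ t in dyadicLevel μ J (k - 1), (∫⁻ s in Iio t, f s ∂l) ^ p ∂μ :=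
        ENNReal.tsum_le_tsum hterm
    _ = ∑' k : ℤ, ∫⁻ t in dyadicLevel μ J k, (∫⁻ s in Iio t, f s ∂l) ^ p ∂μ :=
        (Equiv.subRight (1 : ℤ)).tsum_eq
          fun k => ∫⁻ t in dyadicLevel μ J k, (∫⁻ s in Iio t, f s ∂l) ^ p ∂μ
    _ = ∫⁻ t in ⋃ k, dyadicLevel μ J k, (∫⁻ s in Iio t, f s ∂l) ^ p ∂μ :=
        (lintegral_iUnion hE (pairwise_disjoint_dyadicLevel μ J) _).symm
    _ ≤ _ := setLIntegral_le_lintegral _ _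

/-- Summation of localized inequalities over the dyadic level sets of `t ↦ μ (t, ∞)`. -/
lemma lintegral_rpow_le_of_dyadicLevel {μ η : Measure ℝ} [SFinite η] (hμ : μ ≪ volume) {J : Set ℝ}
    (hJm : MeasurableSet J) (hJb : BddBelow J) (hJa : BddAbove J) (hμJ : ∀ᵐ t ∂μ, t ∈ J)
    (hJ : ∀ t ∈ J, μ (Ioi t) ≠ 0 ∧ μ (Ioi t) ≠ ∞) (f g : ℝ → ℝ≥0∞) {p q r : ℝ} (hp : 0 < p)
    (hpr : p ≤ r) (hrq : r ≤ q) {D : ℝ≥0∞}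
    (h : ∀ k, (∫⁻ t, (∫⁻ s in Iio t, g s ∂(volume.restrict (dyadicLevel μ J k))) ^ (q / r) ∂η)
      ^ (1 / q) ≤ D * (2 ^ (k + 1)) ^ (1 / p) * ∫⁻ s in dyadicLevel μ J k, f s) :
    (∫⁻ t, (∫⁻ s in Iio t, g s ∂(volume.restrict J)) ^ (q / r) ∂η) ^ (1 / q) ≤
      D * 4 ^ (1 / p) * (∫⁻ t, (∫⁻ s in Iio t, f s ∂(volume.restrict J)) ^ p ∂μ) ^ (1 / p) := by
  have hr : 0 < r := by linarith
  have hE : ∀ k, MeasurableSet (dyadicLevel μ J k) := measurableSet_dyadicLevel μ hJm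
  have hsplit : ∀ t, ∫⁻ s in Iio t, g s ∂(volume.restrict J) =
      ∑' k, ∫⁻ s in Iio t, g s ∂(volume.restrict (dyadicLevel μ J k)) := by
    intro t
    nth_rewrite 1 [← iUnion_dyadicLevel hJ]
    rw [Measure.restrict_iUnion (pairwise_disjoint_dyadicLevel μ J) hE,
      Measure.restrict_sum _ measurableSet_Iio, lintegral_sum_measure]
  have hmeas : ∀ k, Measurable fun t =>
      ∫⁻ s in Iio t, g s ∂(volume.restrict (dyadicLevel μ J k)) := fun k =>
    Monotone.measurable fun x y hxy => lintegral_mono_set (Iio_subset_Iio hxy)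
  have hGk : ∀ k, ∫⁻ s in dyadicLevel μ J k, f s ∂(volume.restrict J) =
      ∫⁻ s in dyadicLevel μ J k, f s := by
    intro k
    rw [Measure.restrict_restrict (hE k), inter_eq_left.2 fun t ht => ht.1]
  have hmink := lintegral_tsum_rpow_le (μ := η) hmeas (q := q / r) (by rwa [one_le_div hr])
  simp_rw [← hsplit] at hmink
  have hP : ∀ k, (∫⁻ t, (∫⁻ s in Iio t, g s ∂(volume.restrict (dyadicLevel μ J k))) ^ (q / r) ∂η)
      ^ (1 / (q / r)) ≤ (D ^ p * 4 * (2 ^ (k - 1) * (∫⁻ s in dyadicLevel μ J k, f s) ^ p))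
        ^ (r / p) := by
    intro k
    have h1 := ENNReal.rpow_le_rpow (h k) hr.le
    rw [← ENNReal.rpow_mul, show 1 / q * r = 1 / (q / r) by field_simp] at h1
    refine h1.trans (le_of_eq ?_)
    have h2 : (2 : ℝ≥0∞) ^ (k + 1) = 4 * 2 ^ (k - 1) := by
      rw [show k + 1 = 2 + (k - 1) by ring, ENNReal.zpow_add (by norm_num) (by norm_num)]
      norm_num
    have h3 : D ^ p * 4 * (2 ^ (k - 1) * (∫⁻ s in dyadicLevel μ J k, f s) ^ p) =
        (D * (2 ^ (k + 1)) ^ (1 / p) * ∫⁻ s in dyadicLevel μ J k, f s) ^ p := by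
      rw [ENNReal.mul_rpow_of_nonneg _ _ hp.le, ENNReal.mul_rpow_of_nonneg _ _ hp.le,
        ← ENNReal.rpow_mul, one_div_mul_cancel hp.ne', ENNReal.rpow_one, h2]
      ring
    rw [h3, ← ENNReal.rpow_mul, show p * (r / p) = r by field_simp]
  have hsum : (∫⁻ t, (∫⁻ s in Iio t, g s ∂(volume.restrict J)) ^ (q / r) ∂η) ^ (1 / (q / r)) ≤
      (D ^ p * 4 * ∫⁻ t, (∫⁻ s in Iio t, f s ∂(volume.restrict J)) ^ p ∂μ) ^ (r / p) := by
    refine hmink.trans ((ENNReal.tsum_le_tsum hP).trans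
      ((tsum_rpow_le_rpow_tsum _ (by rwa [one_le_div hp])).trans ?_))
    refine ENNReal.rpow_le_rpow ?_ (by positivity)
    rw [ENNReal.tsum_mul_left]
    refine mul_le_mul_right ?_ _
    have := tsum_dyadicLevel_le (l := volume.restrict J) hμ hJm hJb hJa hμJ hJ f hp
    simpa only [hGk] using this
  have hfin := ENNReal.rpow_le_rpow hsum (by positivity : 0 ≤ 1 / r)
  rw [← ENNReal.rpow_mul, ← ENNReal.rpow_mul, show 1 / (q / r) * (1 / r) = 1 / q by field_simp,
    show r / p * (1 / r) = 1 / p by field_simp, ENNReal.mul_rpow_of_nonneg _ _ (by positivity),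
    ENNReal.mul_rpow_of_nonneg _ _ (by positivity), ← ENNReal.rpow_mul,
    mul_one_div_cancel hp.ne', ENNReal.rpow_one] at hfin
  exact hfin

lemma withDensity_restrict_Ioo_Ioi {a b x : ℝ} (hx : a ≤ x) (g : ℝ → ℝ≥0∞) :
    (volume.restrict (Ioo a b)).withDensity g (Ioi x) = ∫⁻ t in Ioo x b, g t := by
  rw [withDensity_apply _ measurableSet_Ioi, Measure.restrict_restrict measurableSet_Ioi]
  congr 2
  ext t
  exact ⟨fun h => ⟨h.1, h.2.2⟩, fun h => ⟨h.1, hx.trans_lt h.1, h.2⟩⟩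

lemma setLIntegral_Ioo_rpow_mul_eq (a b : ℝ) (g : ℝ → ℝ≥0∞) {u : ℝ → ℝ≥0∞} (hu : Measurable u)
    (e : ℝ) :
    ∫⁻ t in Ioo a b, (∫⁻ s in Ioo a t, g s) ^ e * u t =
      ∫⁻ t, (∫⁻ s in Iio t, g s ∂(volume.restrict (Ioo a b))) ^ e
        ∂((volume.restrict (Ioo a b)).withDensity u) := by
  have hm : Measurable fun t => (∫⁻ s in Iio t, g s ∂(volume.restrict (Ioo a b))) ^ e :=
    (Monotone.measurable fun x y hxy => lintegral_mono_set (Iio_subset_Iio hxy)).pow_const e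
  rw [lintegral_withDensity_eq_lintegral_mul _ hu hm]
  refine setLIntegral_congr_fun measurableSet_Ioo fun t ht => ?_
  have : Iio t ∩ Ioo a b = Ioo a t := by
    ext s
    exact ⟨fun h => ⟨h.2.1, h.1⟩, fun h => ⟨h.2, h.1, h.2.trans ht.2⟩⟩
  simp only [Pi.mul_apply, Measure.restrict_restrict measurableSet_Iio, this]
  rw [mul_comm]

lemma IsWeight.setLIntegral_ne_zero {a b c d : ℝ} {w : ℝ → ℝ≥0∞} (hw : IsWeight a b w)
    (hac : a ≤ c) (hcd : c < d) (hdb : d ≤ b) : ∫⁻ t in Ioo c d, w t ≠ 0 := by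
  rw [← pos_iff_ne_zero, setLIntegral_pos_iff hw.1]
  have : Ioo c d ⊆ Function.support w ∩ Ioo c d := fun t ht =>
    ⟨(hw.2 t ⟨hac.trans_lt ht.1, ht.2.trans_le hdb⟩).1.ne', ht⟩
  refine lt_of_lt_of_le ?_ (measure_mono this)
  simpa using hcd

lemma Vr_mono {r : ℝ} (hr0 : 0 < r) (hr1 : r ≤ 1) (v : ℝ → ℝ≥0∞) {x t t' : ℝ} (h : t ≤ t') :
    Vr r v x t ≤ Vr r v x t' := by
  unfold Vr
  split_ifs with h1
  · exact essSup_mono_measure' (Measure.restrict_mono (Ioo_subset_Ioo_right h) le_rfl)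
  · exact ENNReal.rpow_le_rpow (lintegral_mono_set (Ioo_subset_Ioo_right h))
      (div_nonneg (by linarith) hr0.le)

lemma forall_mul_Vr_le_of_C₁_lt_top {a b r p q : ℝ} (hr0 : 0 < r) (hr1 : r ≤ 1)
    (hp : 0 < p) (hq : 1 ≤ q) {u v w : ℝ → ℝ≥0∞}
    (hw : ∀ x ∈ Ioo a b, 0 < (∫⁻ t in Ioo x b, w t) ∧ (∫⁻ t in Ioo x b, w t) < ∞)
    (hC : C₁ a b r p q u v w ≠ ∞) :
    ∀ᵐ x ∂(volume : Measure ℝ), x ∈ Ioo a b → ∀ t ∈ Ioo x b,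
      (∫⁻ s in Ioo t b, u s) ^ (1 / q) * Vr r v x t ≤
        C₁ a b r p q u v w * (∫⁻ s in Ioo x b, w s) ^ (1 / p) := by
  have hq0 : 0 < q := by linarith
  have hA : ∀ᵐ x ∂(volume : Measure ℝ), x ∈ Ioo a b → _ ≤ C₁ a b r p q u v w :=
    (ae_restrict_iff' measurableSet_Ioo).1 (ENNReal.ae_le_essSup _)
  filter_upwards [hA] with x hx hxJ t ht
  set M := C₁ a b r p q u v w * (∫⁻ s in Ioo x b, w s) ^ (1 / p) with hM
  have hW0 := (hw x hxJ).1.ne'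
  have hWt := (hw x hxJ).2.ne
  have hMtop : M ≠ ∞ := ENNReal.mul_ne_top hC (ENNReal.rpow_ne_top_of_nonneg (by positivity) hWt)
  have hess : essSup (fun t => (∫⁻ s in Ioo t b, u s) ^ (1 / q) * Vr r v x t)
        (volume.restrict (Ioo x b)) ≤ M := by
    have h1 := mul_le_mul_left (hx hxJ) ((∫⁻ s in Ioo x b, w s) ^ (1 / p))
    rwa [mul_right_comm, ← ENNReal.rpow_add _ _ hW0 hWt, neg_add_cancel, ENNReal.rpow_zero,
      one_mul] at h1
  have hae : ∀ᵐ t' ∂(volume : Measure ℝ), t' ∈ Ioo x b →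
      (∫⁻ s in Ioo t' b, u s) ^ (1 / q) * Vr r v x t' ≤ M := by
    refine (ae_restrict_iff' measurableSet_Ioo).1 ?_
    filter_upwards [ENNReal.ae_le_essSup (μ := volume.restrict (Ioo x b))
      (fun t => (∫⁻ s in Ioo t b, u s) ^ (1 / q) * Vr r v x t)] with t' h using h.trans hess
  rcases eq_or_ne (Vr r v x t) 0 with hV | hV
  · rw [hV, mul_zero]; exact zero_le
  have hdiv : ∀ y : ℝ≥0∞, y ^ (1 / q) * Vr r v x t ≤ M ↔ y ≤ (M / Vr r v x t) ^ q := by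
    intro y
    rw [← ENNReal.le_div_iff_mul_le (Or.inl hV) (Or.inr hMtop), one_div,
      ENNReal.rpow_inv_le_iff hq0]
  rw [hdiv]
  have hconv : ∀ t' ∈ Ioo x b, ∫⁻ s in Ioo t' b, u s = volume.withDensity u (Ioo t' b) :=
    fun t' _ => (withDensity_apply _ measurableSet_Ioo).symm
  rw [hconv t ht]
  refine measure_le_of_forall_inter_Ioi_le (withDensity_absolutelyContinuous _ _) bddBelow_Ioo ?_
  filter_upwards [hae] with t' h ht'
  have ht'x : t' ∈ Ioo x b := ⟨ht.1.trans ht'.1, ht'.2⟩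
  refine (measure_mono fun s hs => ⟨hs.2, hs.1.2⟩ : _ ≤ volume.withDensity u (Ioo t' b)).trans ?_
  rw [← hconv t' ht'x, ← hdiv]
  exact (mul_le_mul_right (Vr_mono hr0 hr1 v ht'.1.le) _).trans (h ht'x)

lemma cesCesIneq_of_C₁_lt_top {a b r p q : ℝ} (hr0 : 0 < r) (hr1 : r ≤ 1)
    (hp : 0 < p) (hpr : p ≤ r) (hq : 1 ≤ q) {u v w : ℝ → ℝ≥0∞}
    (hu : IsWeight a b u) (hv : IsWeight a b v) (hw : IsWeight a b w)
    (hW : ∀ x ∈ Ioo a b, 0 < (∫⁻ t in Ioo x b, w t) ∧ (∫⁻ t in Ioo x b, w t) < ∞)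
    (hC : C₁ a b r p q u v w ≠ ∞) :
    CesCesIneq a b r p q u v w
      (4 ^ ((1 - r) / r) * 4 ^ (1 / q) * 4 ^ (1 / p) * C₁ a b r p q u v w) := by
  have hq0 : 0 < q := by linarith
  intro f hf
  set A := C₁ a b r p q u v w with hA
  have hgood := forall_mul_Vr_le_of_C₁_lt_top (v := v) hr0 hr1 hp hq hW hC
  set J := Ioo a b with hJ
  set μ := (volume.restrict J).withDensity w with hμ
  set η := (volume.restrict J).withDensity u with hη
  have hμv : μ ≪ volume :=
    (withDensity_absolutelyContinuous _ _).trans Measure.absolutelyContinuous_restrict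
  have hηv : η ≪ volume :=
    (withDensity_absolutelyContinuous _ _).trans Measure.absolutelyContinuous_restrict
  have hJae : ∀ᵐ t ∂(volume.restrict J), t ∈ J := ae_restrict_mem measurableSet_Ioo
  have hμJ : ∀ᵐ t ∂μ, t ∈ J := (withDensity_absolutelyContinuous _ _).ae_le hJae
  have hηJ : ∀ᵐ t ∂η, t ∈ J := (withDensity_absolutelyContinuous _ _).ae_le hJae
  have hμW : ∀ x ∈ J, μ (Ioi x) = ∫⁻ t in Ioo x b, w t := fun x hx =>
    withDensity_restrict_Ioo_Ioi hx.1.le w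
  have hηU : ∀ x ∈ J, η (Ioi x) = ∫⁻ t in Ioo x b, u t := fun x hx =>
    withDensity_restrict_Ioo_Ioi hx.1.le u
  have hμ0 : ∀ x ∈ J, μ (Ioi x) ≠ 0 ∧ μ (Ioi x) ≠ ∞ := fun x hx => by
    rw [hμW x hx]; exact ⟨(hW x hx).1.ne', (hW x hx).2.ne⟩
  have hη0 : ∀ x ∈ J, η (Ioi x) ≠ 0 := fun x hx => by
    rw [hηU x hx]; exact hu.setLIntegral_ne_zero hx.1.le hx.2 le_rfl
  rw [setLIntegral_Ioo_rpow_mul_eq a b _ hu.1, setLIntegral_Ioo_rpow_mul_eq a b _ hw.1]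
  have key := lintegral_rpow_le_of_dyadicLevel (η := η) hμv measurableSet_Ioo bddBelow_Ioo
    bddAbove_Ioo hμJ hμ0 f (fun s => f s ^ r * v s) hp hpr (hr1.trans hq)
    (D := 4 ^ ((1 - r) / r) * 4 ^ (1 / q) * A) ?_
  · refine key.trans (le_of_eq ?_)
    ring
  intro k
  set S := dyadicLevel μ J k with hS
  have hSm : MeasurableSet S := measurableSet_dyadicLevel μ measurableSet_Ioo k
  have hSJ : S ⊆ J := fun t ht => ht.1
  set B : ℝ≥0∞ := A * (2 ^ (k + 1)) ^ (1 / p) with hB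
  have hBtop : B ≠ ∞ := ENNReal.mul_ne_top hC
    (ENNReal.rpow_ne_top_of_nonneg (by positivity)
      (ENNReal.zpow_ne_top (by norm_num) (by norm_num) _))
  have hgoodB : ∀ᵐ x ∂(volume : Measure ℝ), x ∈ S → ∀ t ∈ Ioo x b,
      η (Ioi t) ^ (1 / q) * Vr r v x t ≤ B := by
    filter_upwards [hgood] with x hx hxS t ht
    rw [hηU t ⟨(hSJ hxS).1.trans ht.1, ht.2⟩]
    refine (hx (hSJ hxS) t ht).trans (mul_le_mul_right (ENNReal.rpow_le_rpow ?_ (by positivity)) _)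
    rw [← hμW x (hSJ hxS)]
    exact hxS.2.2.le
  have hlv : volume.restrict S ≪ (volume : Measure ℝ) := Measure.absolutelyContinuous_restrict
  have hlS : ∀ᵐ t ∂(volume.restrict S), t ∈ S := ae_restrict_mem hSm
  rw [show 4 ^ ((1 - r) / r) * 4 ^ (1 / q) * A * (2 ^ (k + 1)) ^ (1 / p) =
    4 ^ ((1 - r) / r) * 4 ^ (1 / q) * B by rw [hB]; ring]
  rcases hr1.lt_or_eq with hr1 | rfl
  · have hr1' : 0 < 1 - r := by linarith
    have hφ : Measurable fun s => v s ^ (1 / (1 - r)) := hv.1.pow_const _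
    have hvφ : ∀ s, v s = (v s ^ (1 / (1 - r))) ^ (1 - r) := by
      intro s; rw [← ENNReal.rpow_mul, one_div_mul_cancel hr1'.ne', ENNReal.rpow_one]
    have := hardy_rpow_le (l := volume.restrict S) (μ := η) hlv hηv hφ hf hr0 hr1 hq
      (J := J) bddAbove_Ioo hηJ (hlS.mono fun t ht => hSJ ht) hη0 ?_ hBtop ?_
    · simpa only [← hvφ] using this
    · filter_upwards [hlS] with s hs h0
      rw [ENNReal.rpow_eq_zero_iff_of_pos (by positivity)] at h0
      exact (hv.2 s (hSJ hs)).1.ne' h0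
    · intro t ht
      have hU0 : η (Ioi t) ^ (1 / q) ≠ 0 := by
        intro h0
        rw [ENNReal.rpow_eq_zero_iff_of_pos (by positivity)] at h0
        exact hη0 t ht h0
      have hdiv : ∀ y : ℝ≥0∞, η (Ioi t) ^ (1 / q) * y ^ ((1 - r) / r) ≤ B ↔
          y ≤ (B / η (Ioi t) ^ (1 / q)) ^ (r / (1 - r)) := by
        intro y
        rw [mul_comm, ← ENNReal.le_div_iff_mul_le (Or.inl hU0) (Or.inr hBtop),
          show (1 - r) / r = (r / (1 - r))⁻¹ by rw [inv_div],
          ENNReal.rpow_inv_le_iff (by positivity)]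
      rw [hdiv, withDensity_apply _ measurableSet_Iio, Measure.restrict_restrict measurableSet_Iio,
        ← withDensity_apply _ (measurableSet_Iio.inter hSm)]
      refine measure_le_of_forall_inter_Ioi_le (withDensity_absolutelyContinuous _ _)
        (bddBelow_Ioo.mono (inter_subset_right.trans hSJ)) ?_
      filter_upwards [hgoodB] with x hx hxS
      have h1 := hx hxS.2 t ⟨hxS.1, ht.2⟩
      rw [Vr, if_neg hr1.ne, hdiv] at h1
      refine le_trans ?_ h1
      rw [← withDensity_apply _ measurableSet_Ioo]
      exact measure_mono fun s hs => ⟨hs.2, hs.1.1⟩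
  · have hpt : ∀ᵐ s ∂(volume.restrict S), v s * η (Ioi s) ^ (1 / q) ≤ B := by
      have h1 : ∀ t ∈ J, ∀ᵐ s ∂(volume : Measure ℝ), s ∈ S → s < t →
          v s * η (Ioi t) ^ (1 / q) ≤ B := by
        intro t ht
        have h2 : volume {s | s ∈ S ∧ s < t ∧ ¬ v s * η (Ioi t) ^ (1 / q) ≤ B} ≤ 0 := by
          refine measure_le_of_forall_inter_Ioi_le Measure.AbsolutelyContinuous.rfl
            (bddBelow_Ioo.mono fun s hs => hSJ hs.1) ?_
          filter_upwards [hgoodB] with x hx hxS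
          have h3 := hx hxS.1 t ⟨hxS.2.1, ht.2⟩
          rw [Vr, if_pos rfl] at h3
          have h4 := (ae_restrict_iff' measurableSet_Ioo).1
            (ENNReal.ae_le_essSup (μ := volume.restrict (Ioo x t)) v)
          rw [nonpos_iff_eq_zero, ← compl_mem_ae_iff]
          filter_upwards [h4] with s hs hs'
          refine hs'.1.2.2 (le_trans ?_ h3)
          rw [mul_comm]
          exact mul_le_mul_right (hs ⟨hs'.2, hs'.1.2.1⟩) _
        have h5 := nonpos_iff_eq_zero.1 h2
        rw [← compl_mem_ae_iff] at h5
        filter_upwards [h5] with s hs hsS hst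
        by_contra hcon
        exact hs ⟨hsS, hst, hcon⟩
      have hUm : Measurable fun t => η (Ioi t) := (antitone_measure_Ioi η).measurable
      have hswap : ∀ᵐ s ∂(volume : Measure ℝ), ∀ᵐ t ∂(volume : Measure ℝ),
          t ∈ J → s ∈ S → s < t → v s * η (Ioi t) ^ (1 / q) ≤ B := by
        rw [Measure.ae_ae_comm]
        · refine Filter.Eventually.of_forall fun t => ?_
          by_cases ht : t ∈ J
          · filter_upwards [h1 t ht] with s hs _ using hs
          · exact Filter.Eventually.of_forall fun s h => absurd h ht
        · have e1 : MeasurableSet {z : ℝ × ℝ | v z.1 * η (Ioi z.2) ^ (1 / q) ≤ B} :=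
            measurableSet_le ((hv.1.comp measurable_fst).mul
              ((hUm.comp measurable_snd).pow_const _)) measurable_const
          have e2 : MeasurableSet {z : ℝ × ℝ | z.1 < z.2} :=
            measurableSet_lt measurable_fst measurable_snd
          have e3 : MeasurableSet {z : ℝ × ℝ | z.2 ∈ J} := measurable_snd measurableSet_Ioo
          have e4 : MeasurableSet {z : ℝ × ℝ | z.1 ∈ S} := measurable_fst hSm
          exact e3.imp (e4.imp (e2.imp e1))
      filter_upwards [ae_restrict_of_ae hswap, hlS] with s hs hsS
      rcases eq_or_ne (v s) 0 with h0 | h0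
      · rw [h0, zero_mul]; exact zero_le
      have hdiv : ∀ y : ℝ≥0∞, v s * y ^ (1 / q) ≤ B ↔ y ≤ (B / v s) ^ q := by
        intro y
        rw [mul_comm, ← ENNReal.le_div_iff_mul_le (Or.inl h0) (Or.inr hBtop), one_div,
          ENNReal.rpow_inv_le_iff hq0]
      rw [hdiv]
      have hinter : η (Ioi s) = η (Ioo s b) := by
        refine measure_congr ?_
        filter_upwards [hηJ] with t ht
        exact propext ⟨fun h => ⟨h, ht.2⟩, fun h => h.1⟩
      rw [hinter]
      refine measure_le_of_forall_inter_Ioi_le hηv bddBelow_Ioo ?_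
      filter_upwards [hs] with t ht hts
      rw [← hdiv]
      refine le_trans ?_ (ht ⟨(hSJ hsS).1.trans hts.1, hts.2⟩ hsS hts.1)
      exact mul_le_mul_right (ENNReal.rpow_le_rpow (measure_mono inter_subset_right)
        (by positivity)) _
    have hmink := lintegral_setLIntegral_Iio_rpow_le (l := volume.restrict S) (μ := η)
      (hf.mul hv.1) hq
    simp only [ENNReal.rpow_one, div_one, sub_self, ENNReal.rpow_zero, one_mul, Pi.mul_apply]
      at hmink ⊢
    refine hmink.trans ?_
    calc ∫⁻ s in S, f s * v s * η (Ioi s) ^ (1 / q)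
        ≤ ∫⁻ s in S, B * f s := by
          refine lintegral_mono_ae ?_
          filter_upwards [hpt] with s hs
          rw [mul_assoc, mul_comm]
          exact mul_le_mul_left hs _
      _ = B * ∫⁻ s in S, f s := lintegral_const_mul _ hf
      _ ≤ 4 ^ (1 / q) * B * ∫⁻ s in S, f s := by
          refine mul_le_mul_left (le_mul_of_one_le_left' ?_) _
          exact ENNReal.one_le_rpow (by norm_num) (by positivity)

lemma setLIntegral_rpow_mul_le {a b r p q : ℝ} (hr0 : 0 < r) (hp : 0 < p) (hq : 0 < q)
    {u v w : ℝ → ℝ≥0∞} (hu : Measurable u) (hw : Measurable w) {C : ℝ≥0∞}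
    (hC : CesCesIneq a b r p q u v w C)
    {x t : ℝ} (hx : x ∈ Ioo a b) (ht : t ∈ Ioo x b) {f : ℝ → ℝ≥0∞} (hf : Measurable f) :
    (∫⁻ s in Ioo x t, f s ^ r * v s) ^ (1 / r) * (∫⁻ s in Ioo t b, u s) ^ (1 / q) ≤
      C * ((∫⁻ s in Ioo x t, f s) * (∫⁻ s in Ioo x b, w s) ^ (1 / p)) := by
  have hind : ∀ s, (Ioo x t).indicator f s ^ r * v s =
      (Ioo x t).indicator (fun s => f s ^ r * v s) s := by
    intro s
    by_cases h : s ∈ Ioo x t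
    · simp [indicator_of_mem h]
    · simp [indicator_of_notMem h, ENNReal.zero_rpow_of_pos hr0]
  have h := hC _ (hf.indicator measurableSet_Ioo (s := Ioo x t))
  simp only [hind] at h
  refine le_trans ?_ (h.trans (mul_le_mul_right ?_ _))
  · calc (∫⁻ s in Ioo x t, f s ^ r * v s) ^ (1 / r) * (∫⁻ s in Ioo t b, u s) ^ (1 / q)
        = (∫⁻ τ in Ioo t b, (∫⁻ s in Ioo x t, f s ^ r * v s) ^ (q / r) * u τ) ^ (1 / q) := by
          rw [lintegral_const_mul _ hu, ENNReal.mul_rpow_of_nonneg _ _ (by positivity),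
            ← ENNReal.rpow_mul, show q / r * (1 / q) = 1 / r by field_simp]
      _ ≤ _ := by
          refine ENNReal.rpow_le_rpow (le_trans ?_ (lintegral_mono_set
            (Ioo_subset_Ioo_left (hx.1.trans ht.1).le))) (by positivity)
          refine setLIntegral_mono' measurableSet_Ioo fun τ hτ => ?_
          refine mul_le_mul_left (ENNReal.rpow_le_rpow ?_ (by positivity)) _
          rw [setLIntegral_indicator measurableSet_Ioo, inter_eq_left.2
            (Ioo_subset_Ioo hx.1.le hτ.1.le)]
  · calc (∫⁻ τ in Ioo a b, (∫⁻ s in Ioo a τ, (Ioo x t).indicator f s) ^ p * w τ) ^ (1 / p)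
        ≤ (∫⁻ τ in Ioo a b, (Ioo x b).indicator
            (fun τ => (∫⁻ s in Ioo x t, f s) ^ p * w τ) τ) ^ (1 / p) := by
          refine ENNReal.rpow_le_rpow (setLIntegral_mono' measurableSet_Ioo fun τ hτ => ?_)
            (by positivity)
          rw [setLIntegral_indicator measurableSet_Ioo]
          rcases lt_or_ge x τ with hxτ | hxτ
          · rw [indicator_of_mem (show τ ∈ Ioo x b from ⟨hxτ, hτ.2⟩)]
            exact mul_le_mul_left (ENNReal.rpow_le_rpow (lintegral_mono_set inter_subset_left)
              hp.le) _
          · have : Ioo x t ∩ Ioo a τ = ∅ := by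
              ext s; simp only [mem_inter_iff, mem_Ioo, mem_empty_iff_false, iff_false]
              intro h; linarith [h.1.1, h.2.2]
            simp [this, ENNReal.zero_rpow_of_pos hp]
      _ = (∫⁻ s in Ioo x t, f s) * (∫⁻ s in Ioo x b, w s) ^ (1 / p) := by
          rw [setLIntegral_indicator measurableSet_Ioo,
            inter_eq_left.2 (Ioo_subset_Ioo_left hx.1.le), lintegral_const_mul _ hw,
            ENNReal.mul_rpow_of_nonneg _ _ (by positivity), ← ENNReal.rpow_mul,
            mul_one_div_cancel hp.ne', ENNReal.rpow_one]

lemma mul_Vr_le_of_cesCesIneq {a b r p q : ℝ} (hr0 : 0 < r) (hr1 : r ≤ 1) (hp : 0 < p)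
    (hq : 0 < q) {u v w : ℝ → ℝ≥0∞} (hu : Measurable u) (hv : IsWeight a b v)
    (hw : Measurable w) {C : ℝ≥0∞} (hC : CesCesIneq a b r p q u v w C)
    {x t : ℝ} (hx : x ∈ Ioo a b) (ht : t ∈ Ioo x b) :
    (∫⁻ s in Ioo t b, u s) ^ (1 / q) * Vr r v x t ≤ C * (∫⁻ s in Ioo x b, w s) ^ (1 / p) := by
  set U := (∫⁻ s in Ioo t b, u s) ^ (1 / q) with hU
  set M := C * (∫⁻ s in Ioo x b, w s) ^ (1 / p) with hM
  have htest : ∀ f : ℝ → ℝ≥0∞, Measurable f →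
      (∫⁻ s in Ioo x t, f s ^ r * v s) ^ (1 / r) * U ≤ (∫⁻ s in Ioo x t, f s) * M := by
    intro f hf
    refine (setLIntegral_rpow_mul_le hr0 hp hq hu hw hC hx ht hf).trans (le_of_eq ?_)
    rw [hM]; ring
  rcases hr1.lt_or_eq with hr1 | rfl
  · have hr1' : 0 < 1 - r := by linarith
    rw [Vr, if_neg hr1.ne]
    set T : ℕ → Set ℝ := fun n => {s | s ∈ Ioo x t ∧ v s ≤ n} with hT
    have hTm : ∀ n, MeasurableSet (T n) := fun n =>
      measurableSet_Ioo.inter (measurableSet_le hv.1 measurable_const)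
    have hTmono : Monotone T := fun m n hmn s hs => ⟨hs.1, hs.2.trans (by exact_mod_cast hmn)⟩
    have hTU : ⋃ n, T n = Ioo x t := by
      ext s
      refine ⟨fun h => ?_, fun h => ?_⟩
      · obtain ⟨n, hn⟩ := mem_iUnion.1 h
        exact hn.1
      · have hs := (hv.2 s ⟨hx.1.trans h.1, h.2.trans ht.2⟩).2.ne
        obtain ⟨n, hn⟩ := ENNReal.exists_nat_gt hs
        exact mem_iUnion.2 ⟨n, h, hn.le⟩
    set φ : ℝ → ℝ≥0∞ := fun s => v s ^ (1 / (1 - r)) with hφ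
    have hφm : Measurable φ := hv.1.pow_const _
    have hφv : ∀ s ∈ Ioo x t, φ s ^ r * v s = φ s := by
      intro s hs
      have hvs := hv.2 s ⟨hx.1.trans hs.1, hs.2.trans ht.2⟩
      simp only [hφ]
      nth_rewrite 2 [← ENNReal.rpow_one (v s)]
      rw [← ENNReal.rpow_mul, ← ENNReal.rpow_add _ _ hvs.1.ne' hvs.2.ne]
      congr 1; field_simp; ring
    have hn : ∀ n, U * (∫⁻ s in T n, φ s) ^ ((1 - r) / r) ≤ M := by
      intro n
      have h1 := htest _ (hφm.indicator (hTm n))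
      have hind : ∀ s ∈ Ioo x t, (T n).indicator φ s ^ r * v s = (T n).indicator φ s := by
        intro s hs
        by_cases h : s ∈ T n
        · rw [indicator_of_mem h, hφv s hs]
        · rw [indicator_of_notMem h, ENNReal.zero_rpow_of_pos hr0, zero_mul]
      rw [setLIntegral_congr_fun measurableSet_Ioo hind, setLIntegral_indicator (hTm n),
        inter_eq_left.2 fun s hs => hs.1] at h1
      set I := ∫⁻ s in T n, φ s with hI
      have hItop : I ≠ ∞ := by
        have : I ≤ ∫⁻ s in T n, (n : ℝ≥0∞) ^ (1 / (1 - r)) :=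
          setLIntegral_mono' (hTm n) fun s hs => ENNReal.rpow_le_rpow hs.2 (by positivity)
        refine ne_top_of_le_ne_top ?_ this
        rw [setLIntegral_const]
        refine ENNReal.mul_ne_top (ENNReal.rpow_ne_top_of_nonneg (by positivity) (by simp)) ?_
        exact ne_top_of_le_ne_top (by simp)
          (measure_mono fun s (hs : s ∈ T n) => hs.1 : _ ≤ volume (Ioo x t))
      rcases eq_or_ne I 0 with h0 | h0
      · rw [h0, ENNReal.zero_rpow_of_pos (by positivity), mul_zero]; exact zero_le
      · have h2 : I ^ (1 / r) = I * I ^ ((1 - r) / r) := by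
          nth_rewrite 2 [← ENNReal.rpow_one I]
          rw [← ENNReal.rpow_add _ _ h0 hItop]
          congr 1; field_simp; ring
        rw [h2, mul_assoc] at h1
        rw [mul_comm U]
        exact (ENNReal.mul_le_mul_iff_right h0 hItop).1 h1
    have hlim : Filter.Tendsto (fun n => ∫⁻ s in T n, φ s) Filter.atTop
        (nhds (∫⁻ s in Ioo x t, φ s)) := by
      have := tendsto_measure_iUnion_atTop (μ := volume.withDensity φ) hTmono
      rw [hTU, withDensity_apply _ measurableSet_Ioo] at this
      refine this.congr fun n => ?_
      exact withDensity_apply _ (hTm n)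
    rcases eq_or_ne U 0 with hU0 | hU0
    · rw [hU0, zero_mul]; exact zero_le
    have hlim2 := ENNReal.Tendsto.const_mul (a := U)
      ((ENNReal.continuous_rpow_const (y := (1 - r) / r)).continuousAt.tendsto.comp hlim)
      (Or.inl (by
        rw [Ne, ENNReal.rpow_eq_zero_iff_of_pos (by positivity)]
        have hφw : IsWeight a b φ := ⟨hφm, fun s hs =>
          ⟨ENNReal.rpow_pos (hv.2 s hs).1 (hv.2 s hs).2.ne,
            ENNReal.rpow_lt_top_of_nonneg (by positivity) (hv.2 s hs).2.ne⟩⟩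
        exact hφw.setLIntegral_ne_zero hx.1.le ht.1 ht.2.le))
    exact le_of_tendsto' hlim2 hn
  · rw [Vr, if_pos rfl]
    refine ENNReal.mul_le_of_forall_lt fun y hy z hz => ?_
    set T : Set ℝ := {s | s ∈ Ioo x t ∧ z < v s} with hT
    have hTm : MeasurableSet T := measurableSet_Ioo.inter (measurableSet_lt measurable_const hv.1)
    have hT0 : volume T ≠ 0 := by
      intro h0
      refine absurd hz (not_lt.2 (essSup_le_of_ae_le z ?_))
      refine (ae_restrict_iff' measurableSet_Ioo).2 ?_
      rw [← compl_mem_ae_iff] at h0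
      filter_upwards [h0] with s hs hsI
      by_contra hcon
      exact hs ⟨hsI, not_le.1 hcon⟩
    have hTtop : volume T ≠ ∞ :=
      ne_top_of_le_ne_top (by simp) (measure_mono fun s (hs : s ∈ T) => hs.1 : _ ≤ volume (Ioo x t))
    have h1 := htest _ (measurable_one.indicator hTm)
    have hind : ∀ s, T.indicator (1 : ℝ → ℝ≥0∞) s ^ (1 : ℝ) * v s = T.indicator v s := by
      intro s
      by_cases h : s ∈ T
      · simp [indicator_of_mem h]
      · simp [indicator_of_notMem h]
    have hTI : T ∩ Ioo x t = T := inter_eq_left.2 fun s hs => hs.1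
    simp only [hind] at h1
    rw [setLIntegral_indicator hTm, setLIntegral_indicator hTm, hTI, div_one,
      ENNReal.rpow_one] at h1
    simp only [Pi.one_apply, setLIntegral_const, one_mul] at h1
    have h2 : z * volume T ≤ ∫⁻ s in T, v s := by
      rw [← setLIntegral_const]
      exact setLIntegral_mono' hTm fun s hs => hs.2.le
    have h3 : volume T * (y * z) ≤ volume T * M := by
      refine le_trans ?_ h1
      calc volume T * (y * z) = (z * volume T) * y := by ring
        _ ≤ (∫⁻ s in T, v s) * U := mul_le_mul' h2 hy.le
    exact (ENNReal.mul_le_mul_iff_right hT0 hTtop).1 h3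

lemma C₁_le_of_cesCesIneq {a b r p q : ℝ} (hr0 : 0 < r) (hr1 : r ≤ 1) (hp : 0 < p)
    (hq : 0 < q) {u v w : ℝ → ℝ≥0∞} (hu : Measurable u) (hv : IsWeight a b v)
    (hw : Measurable w)
    (hW : ∀ x ∈ Ioo a b, 0 < (∫⁻ t in Ioo x b, w t) ∧ (∫⁻ t in Ioo x b, w t) < ∞)
    {C : ℝ≥0∞} (hC : CesCesIneq a b r p q u v w C) : C₁ a b r p q u v w ≤ C := by
  refine essSup_le_of_ae_le C ?_
  filter_upwards [ae_restrict_mem measurableSet_Ioo] with x hx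
  have h1 : essSup (fun t => (∫⁻ s in Ioo t b, u s) ^ (1 / q) * Vr r v x t)
      (volume.restrict (Ioo x b)) ≤ C * (∫⁻ s in Ioo x b, w s) ^ (1 / p) := by
    refine essSup_le_of_ae_le _ ?_
    filter_upwards [ae_restrict_mem measurableSet_Ioo] with t ht
    exact mul_Vr_le_of_cesCesIneq hr0 hr1 hp hq hu hv hw hC hx ht
  refine (mul_le_mul_right h1 _).trans (le_of_eq ?_)
  rw [mul_left_comm, ← ENNReal.rpow_add _ _ (hW x hx).1.ne' (hW x hx).2.ne, neg_add_cancel,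
    ENNReal.rpow_zero, mul_one]

/-- case (i) of the main theorem: for `p ≤ r ≤ 1 ≤ q` the inequality
holds iff `C₁ < ∞`, and the best constant satisfies `C ≈ C₁` with equivalence
constants depending only on `p, q, r`. -/
theorem main_case_i (p q r : ℝ) (hr0 : 0 < r) (hr1 : r ≤ 1) (hp0 : 0 < p) (hpr : p ≤ r)
    (hq1 : 1 ≤ q) :
    ∃ κ₁ κ₂ : ℝ≥0∞, 0 < κ₁ ∧ κ₂ < ∞ ∧
    ∀ (a b : ℝ), a < b → ∀ u v w : ℝ → ℝ≥0∞,
      IsWeight a b u → IsWeight a b v → IsWeight a b w →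
      (∀ x ∈ Set.Ioo a b,
        0 < (∫⁻ t in Set.Ioo x b, w t) ∧ (∫⁻ t in Set.Ioo x b, w t) < ∞) →
      (((∃ C : ℝ≥0∞, C < ∞ ∧ CesCesIneq a b r p q u v w C) ↔ C₁ a b r p q u v w < ∞) ∧
        κ₁ * C₁ a b r p q u v w ≤ BestC a b r p q u v w ∧
        BestC a b r p q u v w ≤ κ₂ * C₁ a b r p q u v w) := by
  have hq0 : 0 < q := by linarith
  have hκ : (4 ^ ((1 - r) / r) * 4 ^ (1 / q) * 4 ^ (1 / p) : ℝ≥0∞) < ∞ := by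
    have h4 : ∀ e : ℝ, 0 ≤ e → (4 : ℝ≥0∞) ^ e < ∞ := fun e he =>
      ENNReal.rpow_lt_top_of_nonneg he (by norm_num)
    exact ENNReal.mul_lt_top (ENNReal.mul_lt_top
      (h4 _ (div_nonneg (by linarith) hr0.le)) (h4 _ (by positivity))) (h4 _ (by positivity))
  refine ⟨1, 4 ^ ((1 - r) / r) * 4 ^ (1 / q) * 4 ^ (1 / p), one_pos, hκ, ?_⟩
  intro a b _ u v w hu hv hw hW
  refine ⟨⟨?_, fun hC => ?_⟩, ?_, ?_⟩
  · rintro ⟨C, hCtop, hC⟩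
    exact (C₁_le_of_cesCesIneq hr0 hr1 hp0 hq0 hu.1 hv hw.1 hW hC).trans_lt hCtop
  · exact ⟨_, ENNReal.mul_lt_top hκ hC,
      cesCesIneq_of_C₁_lt_top hr0 hr1 hp0 hpr hq1 hu hv hw hW hC.ne⟩
  · rw [one_mul]
    exact le_sInf fun C hC => C₁_le_of_cesCesIneq hr0 hr1 hp0 hq0 hu.1 hv hw.1 hW hC
  · rcases eq_or_ne (C₁ a b r p q u v w) ∞ with h | h
    · rw [h, ENNReal.mul_top]
      · exact le_top
      · simp [ENNReal.rpow_eq_zero_iff]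
    · exact sInf_le (cesCesIneq_of_C₁_lt_top hr0 hr1 hp0 hpr hq1 hu hv hw hW h)
end
end

section
/- Let $0 < p \le q < 1$ and $p \le r \le 1$, and let $u, v, w$ be weights on $(a,b)$ with $0 < \int_x^b w < \infty$ for all $x \in (a,b)$. Then the inequality $\big(\int_a^b \big(\int_a^t f^r v\big)^{q/r} u\,dt\big)^{1/q} \le C \big(\int_a^b \big(\int_a^t f\big)^{p} w\,dt\big)^{1/p}$ holds for all nonnegative measurable $f$ on $(a,b)$ if and only if $C_2 := \sup_{x\in(a,b)} \big(\int_x^b w\big)^{-1/p} \big(\int_x^b \big(\int_t^b u\big)^{q/(1-q)} u(t)\, V_r(x,t)^{q/(1-q)}\, dt\big)^{(1-q)/q} < \infty$; moreover the best constant satisfies $C \approx C_2$. -/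
open MeasureTheory Set ENNReal

noncomputable section

/-- The points of a dyadic decomposition of `[c, b)` with respect to the tail integrals of `g`. -/
structure IsDyadic (g : ℝ → ℝ≥0∞) (c b : ℝ) (t : ℕ → ℝ) : Prop where
  zero : t 0 = c
  strictMono : StrictMono t
  mem : ∀ k, t k ∈ Ico c b
  tail : ∀ k, ∫⁻ s in Ioo (t k) b, g s = 2⁻¹ ^ k * ∫⁻ s in Ioo c b, g s
  piece : ∀ k, ∫⁻ s in Ico (t k) (t (k + 1)), g s = 2⁻¹ ^ (k + 1) * ∫⁻ s in Ioo c b, g s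
  cover : ⋃ k, Ico (t k) (t (k + 1)) = Ico c b

lemma setLIntegral_Ioo_eq_Ico (f : ℝ → ℝ≥0∞) (c d : ℝ) :
    ∫⁻ s in Ioo c d, f s = ∫⁻ s in Ico c d, f s :=
  setLIntegral_congr Ioo_ae_eq_Ico

lemma setLIntegral_Ico_add {f : ℝ → ℝ≥0∞} {c d e : ℝ} (hcd : c ≤ d) (hde : d ≤ e) :
    (∫⁻ s in Ico c d, f s) + ∫⁻ s in Ico d e, f s = ∫⁻ s in Ico c e, f s := by
  rw [← Ico_union_Ico_eq_Ico hcd hde, lintegral_union measurableSet_Ico Ico_disjoint_Ico_same]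

lemma continuousOn_tail {g : ℝ → ℝ≥0∞} (hg : Measurable g) {c b : ℝ} (hcb : c < b)
    (hfin : ∫⁻ s in Ioo c b, g s ≠ ∞) :
    ContinuousOn (fun t => ∫⁻ s in Ioo t b, g s) (Icc c b) := by
  have hint : IntegrableOn (fun s => (g s).toReal) (uIcc c b) := by
    rw [uIcc_of_le hcb.le, integrableOn_Icc_iff_integrableOn_Ioo]
    exact integrable_toReal_of_lintegral_ne_top hg.aemeasurable hfin
  have h := intervalIntegral.continuousOn_primitive_interval_left hint
  rw [uIcc_of_le hcb.le] at h
  refine (ENNReal.continuous_ofReal.comp_continuousOn h).congr ?_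
  intro t ht
  have hfin' : ∫⁻ s in Ioo t b, g s ≠ ∞ :=
    ne_top_of_le_ne_top hfin (lintegral_mono_set (Ioo_subset_Ioo_left ht.1))
  simp only [Function.comp]
  rw [intervalIntegral.integral_of_le ht.2, ← integral_Ioc_eq_integral_Ioo.symm,
    integral_toReal hg.aemeasurable (ae_lt_top hg hfin'), ENNReal.ofReal_toReal hfin']

lemma exists_isDyadic {g : ℝ → ℝ≥0∞} (hg : Measurable g) {c b : ℝ} (hcb : c < b)
    (hpos : ∀ t ∈ Ico c b, 0 < ∫⁻ s in Ioo t b, g s) (hfin : ∫⁻ s in Ioo c b, g s ≠ ∞) :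
    ∃ t, IsDyadic g c b t := by
  set G : ℝ → ℝ≥0∞ := fun t => ∫⁻ s in Ioo t b, g s with hG
  have hcont := continuousOn_tail hg hcb hfin
  have hanti : Antitone G := fun x y hxy => lintegral_mono_set (Ioo_subset_Ioo_left hxy)
  have hGb : G b = 0 := by simp [hG]
  have hGc : G c ≠ 0 := (hpos c ⟨le_rfl, hcb⟩).ne'
  have hlt : ∀ k : ℕ, (2⁻¹ : ℝ≥0∞) ^ (k + 1) * G c < 2⁻¹ ^ k * G c := by
    intro k
    refine ENNReal.mul_lt_mul_left hGc hfin ?_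
    rw [pow_succ]
    refine ENNReal.mul_lt_of_lt_div' ?_
    rw [ENNReal.div_self (by simp) (by simp)]
    simp [ENNReal.inv_lt_one]
  have hex : ∀ k : ℕ, ∃ x ∈ Ico c b, G x = 2⁻¹ ^ k * G c ∧ (k = 0 → x = c) := by
    intro k
    rcases Nat.eq_zero_or_pos k with rfl | hk
    · exact ⟨c, ⟨le_rfl, hcb⟩, by simp, fun _ => rfl⟩
    · have : (2⁻¹ : ℝ≥0∞) ^ k * G c ∈ Icc (G b) (G c) := by
        rw [hGb]
        refine ⟨zero_le, mul_le_of_le_one_left zero_le (pow_le_one₀ zero_le (by simp))⟩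
      obtain ⟨x, hx, hxe⟩ := intermediate_value_Icc' hcb.le hcont this
      refine ⟨x, ⟨hx.1, lt_of_le_of_ne hx.2 ?_⟩, hxe, fun h => absurd h hk.ne'⟩
      rintro rfl
      have h0 : G x = 2⁻¹ ^ k * G c := hxe
      rw [hGb] at h0
      have := mul_eq_zero.1 h0.symm
      simp [hGc] at this
  choose t ht htG ht0 using hex
  have hmono : StrictMono t := by
    refine strictMono_nat_of_lt_succ fun k => ?_
    by_contra! h
    have := hanti h
    rw [htG, htG] at this
    exact absurd this (not_le.2 (hlt k))
  have ht0 : t 0 = c := ht0 0 rfl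
  refine ⟨t, ht0, hmono, ht, htG, ?_, ?_⟩
  · intro k
    have h1 := setLIntegral_Ico_add (f := g) (hmono (Nat.lt_succ_self k)).le (ht (k + 1)).2.le
    rw [← setLIntegral_Ioo_eq_Ico g _ b, ← setLIntegral_Ioo_eq_Ico g _ b] at h1
    change _ + G _ = G _ at h1
    rw [htG, htG] at h1
    have h2 : (2⁻¹ : ℝ≥0∞) ^ k * G c = 2⁻¹ ^ (k + 1) * G c + 2⁻¹ ^ (k + 1) * G c := by
      rw [← two_mul, ← mul_assoc, pow_succ', ← mul_assoc,
        ENNReal.mul_inv_cancel (by simp) (by simp), one_mul]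
    rw [h2] at h1
    exact (ENNReal.add_left_inj (ENNReal.mul_ne_top (by simp) hfin)).1 h1
  · apply Subset.antisymm
    · refine iUnion_subset fun k => ?_
      exact fun s hs => ⟨(ht k).1.trans hs.1, hs.2.trans (ht (k + 1)).2⟩
    · intro s hs
      have hk : ∃ k, s < t k := by
        have h1 : Filter.Tendsto (fun k : ℕ => (2⁻¹ : ℝ≥0∞) ^ k * G c) Filter.atTop (nhds 0) := by
          have := ENNReal.Tendsto.mul_const (b := G c)
            (ENNReal.tendsto_pow_atTop_nhds_zero_of_lt_one (r := 2⁻¹) (by simp [ENNReal.inv_lt_one]))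
            (Or.inr hfin)
          simpa using this
        obtain ⟨k, hk⟩ := (h1.eventually (gt_mem_nhds (hpos s hs))).exists
        refine ⟨k, ?_⟩
        by_contra! h
        have := hanti h
        rw [htG] at this
        exact absurd this (not_le.2 hk)
      classical
      have hspec := Nat.find_spec hk
      have hne : Nat.find hk ≠ 0 := by
        intro h0
        rw [h0, ht0] at hspec
        exact absurd hspec (not_lt.2 hs.1)
      obtain ⟨m, hm⟩ := Nat.exists_eq_succ_of_ne_zero hne
      rw [hm] at hspec
      refine mem_iUnion.2 ⟨m, not_lt.1 (Nat.find_min hk (by omega)), hspec⟩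

lemma IsDyadic.lintegral_eq_tsum {g : ℝ → ℝ≥0∞} {c b : ℝ} {t : ℕ → ℝ} (ht : IsDyadic g c b t)
    (f : ℝ → ℝ≥0∞) : ∫⁻ s in Ioo c b, f s = ∑' k, ∫⁻ s in Ico (t k) (t (k + 1)), f s := by
  rw [setLIntegral_Ioo_eq_Ico, ← ht.cover, lintegral_iUnion (fun _ => measurableSet_Ico)]
  exact ht.strictMono.monotone.pairwise_disjoint_on_Ico_succ

lemma IsDyadic.lintegral_eq_sum {g : ℝ → ℝ≥0∞} {c b : ℝ} {t : ℕ → ℝ} (ht : IsDyadic g c b t)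
    (f : ℝ → ℝ≥0∞) (n : ℕ) : ∫⁻ s in Ico c (t n), f s =
      ∑ k ∈ Finset.range n, ∫⁻ s in Ico (t k) (t (k + 1)), f s := by
  induction n with
  | zero => simp [ht.zero]
  | succ n ih =>
    rw [Finset.sum_range_succ, ← ih, setLIntegral_Ico_add (ht.mem n).1
      (ht.strictMono (Nat.lt_succ_self n)).le]

lemma tsum_sum_range_eq (F : ℕ → ℕ → ℝ≥0∞) :
    ∑' k, ∑ i ∈ Finset.range (k + 1), F i (k - i) = ∑' i, ∑' m, F i m := by
  simp_rw [← Finset.Nat.sum_antidiagonal_eq_sum_range_succ F, ← ENNReal.tsum_prod]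
  rw [← Finset.HasAntidiagonal.sigmaAntidiagonalEquivProd.tsum_eq, ENNReal.tsum_sigma']
  refine tsum_congr fun k => ?_
  rw [← Finset.tsum_subtype]
  rfl

lemma discrete_hardy {β : ℝ} (hβ : 0 < β) : ∃ K : ℝ≥0∞, K ≠ ∞ ∧ ∀ h : ℕ → ℝ≥0∞,
    ∑' k, 2⁻¹ ^ k * (∑ j ∈ Finset.range (k + 1), h j) ^ β ≤ K * ∑' k, 2⁻¹ ^ k * h k ^ β := by
  obtain ⟨a, ha⟩ : ∃ a : ℝ≥0∞, a = (4 / 3)⁻¹ := ⟨_, rfl⟩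
  have h43 : (1 : ℝ≥0∞) < 4 / 3 := by
    rw [ENNReal.lt_div_iff_mul_lt (by simp) (by simp)]; norm_num
  have h43t : (4 / 3 : ℝ≥0∞) ≠ ∞ := ENNReal.div_ne_top (by simp) (by simp)
  have ha0 : a ≠ 0 := by rw [ha]; exact ENNReal.inv_ne_zero.2 h43t
  have ha1 : a < 1 := by rw [ha]; exact ENNReal.inv_lt_one.2 h43
  have hat : a ≠ ∞ := (ha1.trans ENNReal.one_lt_top).ne
  set ρ : ℝ≥0∞ := a ^ (1 / β)
  have hρ : ρ < 1 := ENNReal.rpow_lt_one ha1 (by positivity)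
  set b : ℝ≥0∞ := 2⁻¹ * a⁻¹
  have hb : b < 1 := by
    simp only [b, ha, inv_inv]
    rw [mul_comm, ← div_eq_mul_inv]
    refine ENNReal.div_lt_of_lt_mul ?_
    refine ENNReal.div_lt_of_lt_mul ?_
    norm_num
  refine ⟨(∑' n, ρ ^ n) ^ β * ∑' n, b ^ n, ?_, ?_⟩
  · refine ENNReal.mul_ne_top (ENNReal.rpow_ne_top_of_nonneg hβ.le ?_) ?_
    · rw [ENNReal.tsum_geometric]; simpa [tsub_eq_zero_iff_le] using hρ
    · rw [ENNReal.tsum_geometric]; simpa [tsub_eq_zero_iff_le] using hb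
  · intro h
    have key : ∀ k, (2⁻¹ : ℝ≥0∞) ^ k * (∑ j ∈ Finset.range (k + 1), h j) ^ β ≤
        (∑' n, ρ ^ n) ^ β * ∑ i ∈ Finset.range (k + 1), (2⁻¹ ^ i * h i ^ β) * b ^ (k - i) := by
      intro k
      set T := ∑ i ∈ Finset.range (k + 1), (a⁻¹) ^ (k - i) * h i ^ β
      have h1 : ∀ j ∈ Finset.range (k + 1), h j ≤ ρ ^ (k - j) * T ^ (1 / β) := by
        intro j hj
        have h2 : h j ^ β ≤ a ^ (k - j) * T := by
          have : (a⁻¹) ^ (k - j) * h j ^ β ≤ T :=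
            Finset.single_le_sum (f := fun i => (a⁻¹) ^ (k - i) * h i ^ β) (fun _ _ => zero_le) hj
          calc h j ^ β = a ^ (k - j) * ((a⁻¹) ^ (k - j) * h j ^ β) := by
                rw [← mul_assoc, ← mul_pow, ENNReal.mul_inv_cancel ha0 hat, one_pow, one_mul]
            _ ≤ _ := by gcongr
        calc h j = (h j ^ β) ^ (1 / β) := by
              rw [← ENNReal.rpow_mul, mul_one_div_cancel hβ.ne', ENNReal.rpow_one]
          _ ≤ (a ^ (k - j) * T) ^ (1 / β) := by gcongr
          _ = _ := by
              rw [ENNReal.mul_rpow_of_nonneg _ _ (by positivity)]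
              simp only [ρ]
              rw [← ENNReal.rpow_natCast, ← ENNReal.rpow_natCast, ← ENNReal.rpow_mul,
                ← ENNReal.rpow_mul, mul_comm (1 / β)]
      have h3 : ∑ j ∈ Finset.range (k + 1), h j ≤ (∑' n, ρ ^ n) * T ^ (1 / β) := by
        refine (Finset.sum_le_sum h1).trans ?_
        rw [← Finset.sum_mul]
        gcongr
        have := Finset.sum_range_reflect (fun n => ρ ^ n) (k + 1)
        simp only [Nat.add_sub_cancel] at this
        rw [this]
        exact ENNReal.sum_le_tsum _
      calc (2⁻¹ : ℝ≥0∞) ^ k * (∑ j ∈ Finset.range (k + 1), h j) ^ β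
          ≤ 2⁻¹ ^ k * ((∑' n, ρ ^ n) * T ^ (1 / β)) ^ β := by gcongr
        _ = (∑' n, ρ ^ n) ^ β * (2⁻¹ ^ k * T) := by
            rw [ENNReal.mul_rpow_of_nonneg _ _ hβ.le, ← ENNReal.rpow_mul,
              one_div_mul_cancel hβ.ne', ENNReal.rpow_one]
            ring
        _ = _ := by
            congr 1
            rw [Finset.mul_sum]
            refine Finset.sum_congr rfl fun i hi => ?_
            have hik : k = i + (k - i) := by have := Finset.mem_range.1 hi; omega
            simp only [b]
            conv_lhs => rw [hik, pow_add]
            rw [mul_pow, Nat.add_sub_cancel_left]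
            ring
    refine (ENNReal.tsum_le_tsum key).trans ?_
    rw [ENNReal.tsum_mul_left, tsum_sum_range_eq (fun i m => (2⁻¹ ^ i * h i ^ β) * b ^ m)]
    simp_rw [ENNReal.tsum_mul_left, ENNReal.tsum_mul_right]
    rw [mul_assoc, mul_comm (∑' n, b ^ n)]

lemma tsum_rpow_mul_rpow_le (x y : ℕ → ℝ≥0∞) {p q : ℝ} (hp : 0 ≤ p) (hq : 0 ≤ q)
    (hpq : p + q = 1) : ∑' k, x k ^ p * y k ^ q ≤ (∑' k, x k) ^ p * (∑' k, y k) ^ q := by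
  simpa [lintegral_count] using ENNReal.lintegral_mul_norm_pow_le (μ := Measure.count)
    (measurable_of_countable x).aemeasurable (measurable_of_countable y).aemeasurable hp hq hpq

lemma tsum_rpow_le (x : ℕ → ℝ≥0∞) {p : ℝ} (hp : 0 < p) (hp1 : p ≤ 1) :
    (∑' k, x k) ^ p ≤ ∑' k, x k ^ p := by
  have hfin : ∀ n, (∑ k ∈ Finset.range n, x k) ^ p ≤ ∑ k ∈ Finset.range n, x k ^ p := by
    intro n
    induction n with
    | zero => simp [hp]
    | succ n ih =>
      rw [Finset.sum_range_succ, Finset.sum_range_succ]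
      exact (ENNReal.rpow_add_le_add_rpow _ _ hp.le hp1).trans (by gcongr)
  rw [← ENNReal.le_rpow_inv_iff hp]
  rw [ENNReal.tsum_eq_iSup_nat]
  refine iSup_le fun n => ?_
  rw [ENNReal.le_rpow_inv_iff hp]
  exact (hfin n).trans (ENNReal.sum_le_tsum _)

lemma lintegral_tsum_rpow_le_s6 {α : Type*} [MeasurableSpace α] {μ : Measure α}
    {f : ℕ → α → ℝ≥0∞} (hf : ∀ n, Measurable (f n)) {s : ℝ} (hs : 1 ≤ s) :
    (∫⁻ x, (∑' n, f n x) ^ s ∂μ) ^ (1 / s) ≤ ∑' n, (∫⁻ x, f n x ^ s ∂μ) ^ (1 / s) := by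
  have hs0 : 0 < s := by linarith
  have hfin : ∀ n, (∫⁻ x, (∑ k ∈ Finset.range n, f k x) ^ s ∂μ) ^ (1 / s) ≤
      ∑ k ∈ Finset.range n, (∫⁻ x, f k x ^ s ∂μ) ^ (1 / s) := by
    intro n
    induction n with
    | zero => simp [hs0]
    | succ n ih =>
      simp_rw [Finset.sum_range_succ]
      refine (ENNReal.lintegral_Lp_add_le (f := fun x => ∑ k ∈ Finset.range n, f k x) (g := f n)
        (Finset.measurable_fun_sum _ fun i _ => hf i).aemeasurable (hf n).aemeasurable hs).trans ?_
      gcongr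
  have hlim : ∫⁻ x, (∑' n, f n x) ^ s ∂μ =
      ⨆ n, ∫⁻ x, (∑ k ∈ Finset.range n, f k x) ^ s ∂μ := by
    rw [← lintegral_iSup]
    · refine lintegral_congr fun x => ?_
      rw [ENNReal.tsum_eq_iSup_nat]
      exact (ENNReal.orderIsoRpow s hs0).map_iSup _
    · exact fun n => (Finset.measurable_fun_sum _ fun i _ => hf i).pow_const _
    · intro m n hmn x
      simp only
      gcongr
  rw [one_div, ENNReal.rpow_inv_le_iff hs0, hlim]
  refine iSup_le fun n => ?_
  rw [← ENNReal.rpow_inv_le_iff hs0, ← one_div]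
  exact (hfin n).trans (ENNReal.sum_le_tsum _)

lemma Vr_mono_s6 {r : ℝ} (hr : 0 < r) (hr1 : r ≤ 1) (v : ℝ → ℝ≥0∞) (c : ℝ) :
    Monotone (Vr r v c) := by
  intro d d' h
  have hle : volume.restrict (Ioo c d) ≤ volume.restrict (Ioo c d') :=
    Measure.restrict_mono (Ioo_subset_Ioo_right h) le_rfl
  unfold Vr
  split_ifs
  · exact essSup_mono_measure hle.absolutelyContinuous
  · have : 0 ≤ (1 - r) / r := div_nonneg (by linarith) hr.le
    gcongr

lemma lintegral_rpow_mul_le_Vr {r : ℝ} (hr : 0 < r) (hr1 : r ≤ 1) {v f : ℝ → ℝ≥0∞}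
    (hv : Measurable v) (hf : Measurable f) {c d : ℝ} {μ : Measure ℝ}
    (hμ : μ ≤ volume.restrict (Ioo c d)) :
    ∫⁻ s, f s ^ r * v s ∂μ ≤ (∫⁻ s, f s ∂μ) ^ r * Vr r v c d ^ r := by
  unfold Vr
  split_ifs with h1
  · subst h1
    simp only [ENNReal.rpow_one]
    rw [← lintegral_mul_const _ hf]
    refine lintegral_mono_ae ?_
    filter_upwards [hμ.absolutelyContinuous.ae_le (_root_.ae_le_essSup (f := v))] with s hs
    gcongr
  · have hr1' : 0 < 1 - r := by
      rcases hr1.lt_or_eq with h | h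
      · linarith
      · exact absurd h h1
    have hH := ENNReal.lintegral_mul_norm_pow_le (μ := μ) hf.aemeasurable
      (hv.pow_const (1 / (1 - r))).aemeasurable hr.le hr1'.le (by ring)
    have he : ∀ s, (v s ^ (1 / (1 - r))) ^ (1 - r) = v s := fun s => by
      rw [← ENNReal.rpow_mul, one_div_mul_cancel hr1'.ne', ENNReal.rpow_one]
    simp_rw [he] at hH
    refine hH.trans ?_
    rw [← ENNReal.rpow_mul, div_mul_cancel₀ _ hr.ne']
    gcongr

lemma Vr_pos {r : ℝ} (hr : 0 < r) (hr1 : r ≤ 1) {v : ℝ → ℝ≥0∞} (hv : Measurable v) {c d : ℝ}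
    (hcd : c < d) (hpos : ∀ s ∈ Ioo c d, 0 < v s) : 0 < Vr r v c d := by
  by_contra! h0
  have h0 : Vr r v c d = 0 := le_antisymm h0 zero_le
  have := lintegral_rpow_mul_le_Vr hr hr1 hv (f := fun _ => 1) measurable_const
    (le_refl (volume.restrict (Ioo c d)))
  rw [h0, ENNReal.zero_rpow_of_pos hr, mul_zero] at this
  have h2 : 0 < ∫⁻ s in Ioo c d, (1 : ℝ≥0∞) ^ r * v s := by
    rw [setLIntegral_pos_iff (by fun_prop)]
    have : Ioo c d ⊆ Function.support (fun s => (1 : ℝ≥0∞) ^ r * v s) ∩ Ioo c d := by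
      intro s hs
      exact ⟨by simpa using (hpos s hs).ne', hs⟩
    refine lt_of_lt_of_le ?_ (measure_mono this)
    simpa using hcd
  exact absurd this (not_le.2 h2)

lemma exists_test_function {r : ℝ} (hr : 0 < r) (hr1 : r ≤ 1) {v : ℝ → ℝ≥0∞}
    (hv : Measurable v) {c d : ℝ} {l : ℝ≥0∞} (hl : l < Vr r v c d) :
    ∃ f : ℝ → ℝ≥0∞, Measurable f ∧ ∫⁻ s, f s ≤ 1 ∧ l ^ r ≤ ∫⁻ s in Ioo c d, f s ^ r * v s := by
  unfold Vr at hl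
  split_ifs at hl with h1
  · subst h1
    have hA : volume ({s | l < v s} ∩ Ioo c d) ≠ 0 := by
      intro h0
      refine absurd hl (not_lt.2 (essSup_le_of_ae_le l ?_))
      rw [Filter.EventuallyLE, ae_iff, Measure.restrict_apply₀']
      · simpa using h0
      · exact measurableSet_Ioo.nullMeasurableSet
    have hAm : MeasurableSet ({s | l < v s} ∩ Ioo c d) :=
      (measurableSet_lt measurable_const hv).inter measurableSet_Ioo
    have hAt : volume ({s | l < v s} ∩ Ioo c d) ≠ ∞ :=
      measure_ne_top_of_subset inter_subset_right (by simp)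
    set A := {s | l < v s} ∩ Ioo c d
    refine ⟨A.indicator fun _ => (volume A)⁻¹, measurable_const.indicator hAm, ?_, ?_⟩
    · rw [lintegral_indicator hAm]
      simp [ENNReal.inv_mul_cancel hA hAt]
    · simp only [ENNReal.rpow_one]
      calc l = ∫⁻ s in A, (volume A)⁻¹ * l := by
            simp only [lintegral_const, Measure.restrict_apply_univ]
            rw [mul_right_comm, ENNReal.inv_mul_cancel hA hAt, one_mul]
        _ ≤ ∫⁻ s in A, A.indicator (fun _ => (volume A)⁻¹) s * v s := by
            refine setLIntegral_mono' hAm fun s hs => ?_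
            rw [indicator_of_mem hs]
            gcongr
            exact hs.1.le
        _ ≤ _ := lintegral_mono_set inter_subset_right
  · have hr1' : 0 < 1 - r := by
      rcases hr1.lt_or_eq with h | h
      · linarith
      · exact absurd h h1
    have he : 0 < (1 - r) / r := div_pos hr1' hr
    have hs0 : 0 < 1 / (1 - r) := by positivity
    set σ := 1 / (1 - r) with hσ
    set M : ℕ → ℝ≥0∞ := fun n => ∫⁻ s in Ioo c d, (min (v s) n) ^ σ
    have hM : ∫⁻ s in Ioo c d, v s ^ σ = ⨆ n, M n := by
      rw [← lintegral_iSup]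
      · refine lintegral_congr fun s => ?_
        have : v s = ⨆ n : ℕ, min (v s) n := by
          rw [← inf_iSup_eq, ENNReal.iSup_natCast, inf_top_eq]
        conv_lhs => rw [this]
        exact (ENNReal.orderIsoRpow σ hs0).map_iSup _
      · exact fun n => (hv.min measurable_const).pow_const _
      · intro m n hmn s
        simp only
        gcongr
    rw [hM, show ((⨆ n, M n) ^ ((1 - r) / r)) = ⨆ n, M n ^ ((1 - r) / r) from
      (ENNReal.orderIsoRpow _ he).map_iSup _] at hl
    obtain ⟨n, hn⟩ := lt_iSup_iff.1 hl
    have hM0 : M n ≠ 0 := by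
      intro h0
      rw [h0, ENNReal.zero_rpow_of_pos he] at hn
      exact absurd hn ENNReal.not_lt_zero
    have hMt : M n ≠ ∞ := by
      refine ne_top_of_le_ne_top ?_ (setLIntegral_mono' measurableSet_Ioo
        (g := fun _ => (n : ℝ≥0∞) ^ σ) fun s _ => ?_)
      · simp only [lintegral_const, Measure.restrict_apply_univ]
        exact ENNReal.mul_ne_top (ENNReal.rpow_ne_top_of_nonneg hs0.le (by simp)) (by simp)
      · gcongr
        exact min_le_right _ _
    refine ⟨(Ioo c d).indicator fun s => (M n)⁻¹ * (min (v s) n) ^ σ,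
      (((hv.min measurable_const).pow_const _).const_mul _).indicator measurableSet_Ioo, ?_, ?_⟩
    · rw [lintegral_indicator measurableSet_Ioo, lintegral_const_mul _
        ((hv.min measurable_const).pow_const _)]
      exact (ENNReal.inv_mul_cancel hM0 hMt).le
    · calc l ^ r ≤ (M n ^ ((1 - r) / r)) ^ r := by gcongr
        _ = (M n)⁻¹ ^ r * M n := by
            rw [← ENNReal.rpow_mul, div_mul_cancel₀ _ hr.ne', ENNReal.inv_rpow,
              ENNReal.rpow_sub _ _ hM0 hMt, ENNReal.rpow_one, div_eq_mul_inv, mul_comm]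
        _ = ∫⁻ s in Ioo c d, (M n)⁻¹ ^ r * (min (v s) n) ^ σ := by
            rw [lintegral_const_mul _ ((hv.min measurable_const).pow_const _)]
        _ ≤ _ := by
            refine setLIntegral_mono' measurableSet_Ioo fun s hs => ?_
            rw [indicator_of_mem hs, ENNReal.mul_rpow_of_nonneg _ _ hr.le, mul_assoc]
            gcongr
            rw [← ENNReal.rpow_mul]
            calc (min (v s) n) ^ σ = (min (v s) n) ^ (σ * r + 1) := by
                  congr 1; rw [hσ]; field_simp; ring
              _ = (min (v s) n) ^ (σ * r) * min (v s) n := by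
                  rw [ENNReal.rpow_add_of_nonneg _ _ (by positivity) zero_le_one,
                    ENNReal.rpow_one]
              _ ≤ _ := by gcongr; exact min_le_left _ _

lemma inv_two_pow_mul_eq (k : ℕ) (E : ℝ≥0∞) : 2⁻¹ ^ k * E = 4 * (2⁻¹ ^ (k + 2) * E) := by
  have h4 : (4 : ℝ≥0∞) * 2⁻¹ ^ 2 = 1 := by
    rw [show (4 : ℝ≥0∞) = 2 ^ 2 by norm_num, ← mul_pow,
      ENNReal.mul_inv_cancel (by simp) (by simp), one_pow]
  calc 2⁻¹ ^ k * E = (4 * 2⁻¹ ^ 2) * (2⁻¹ ^ k * E) := by rw [h4, one_mul]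
    _ = _ := by ring

lemma measurable_primitive (c : ℝ) (f : ℝ → ℝ≥0∞) :
    Measurable fun t => ∫⁻ s in Ioo c t, f s :=
  Monotone.measurable fun _ _ h => lintegral_mono_set (Ioo_subset_Ioo_right h)

lemma IsDyadic.lintegral_le_tsum {u : ℝ → ℝ≥0∞} (hu : Measurable u) {c b : ℝ} {t : ℕ → ℝ}
    (ht : IsDyadic u c b t) {V : ℝ → ℝ≥0∞} (hV : Monotone V) {θ : ℝ} (hθ : 0 ≤ θ) :
    ∫⁻ x in Ioo c b, (∫⁻ s in Ioo x b, u s) ^ θ * u x * V x ^ θ ≤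
      ∑' k, (2⁻¹ ^ k * ∫⁻ s in Ioo c b, u s) ^ (1 + θ) * V (t (k + 1)) ^ θ := by
  rw [ht.lintegral_eq_tsum]
  refine ENNReal.tsum_le_tsum fun k => ?_
  set E := ∫⁻ s in Ioo c b, u s
  calc ∫⁻ x in Ico (t k) (t (k + 1)), (∫⁻ s in Ioo x b, u s) ^ θ * u x * V x ^ θ
      ≤ ∫⁻ x in Ico (t k) (t (k + 1)), ((2⁻¹ ^ k * E) ^ θ * V (t (k + 1)) ^ θ) * u x := by
        refine setLIntegral_mono' measurableSet_Ico fun x hx => ?_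
        rw [mul_right_comm]
        gcongr
        · rw [← ht.tail k]
          exact lintegral_mono_set (Ioo_subset_Ioo_left hx.1)
        · exact hV hx.2.le
    _ = (2⁻¹ ^ k * E) ^ θ * V (t (k + 1)) ^ θ * (2⁻¹ ^ (k + 1) * E) := by
        rw [lintegral_const_mul _ hu, ht.piece]
    _ ≤ (2⁻¹ ^ k * E) ^ θ * V (t (k + 1)) ^ θ * (2⁻¹ ^ k * E) := by
        gcongr _ * (?_ * _)
        exact pow_le_pow_of_le_one zero_le (by simp) (Nat.le_succ k)
    _ = _ := by
        rw [ENNReal.rpow_add_of_nonneg _ _ zero_le_one hθ, ENNReal.rpow_one]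
        ring

lemma IsDyadic.tsum_le_lintegral {u : ℝ → ℝ≥0∞} (hu : Measurable u) {c b : ℝ} {t : ℕ → ℝ}
    (ht : IsDyadic u c b t) {V : ℝ → ℝ≥0∞} (hV : Monotone V) {θ : ℝ} (hθ : 0 ≤ θ) :
    ∑' k, (2⁻¹ ^ k * ∫⁻ s in Ioo c b, u s) ^ (1 + θ) * V (t (k + 1)) ^ θ ≤
      4 ^ (1 + θ) * ∫⁻ x in Ioo c b, (∫⁻ s in Ioo x b, u s) ^ θ * u x * V x ^ θ := by
  set E := ∫⁻ s in Ioo c b, u s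
  set F : ℝ → ℝ≥0∞ := fun x => (∫⁻ s in Ioo x b, u s) ^ θ * u x * V x ^ θ
  have key : ∀ k, (2⁻¹ ^ k * E) ^ (1 + θ) * V (t (k + 1)) ^ θ ≤
      4 ^ (1 + θ) * ∫⁻ x in Ico (t (k + 1)) (t (k + 1 + 1)), F x := by
    intro k
    rw [inv_two_pow_mul_eq k E, ENNReal.mul_rpow_of_nonneg _ _ (by positivity), mul_assoc]
    gcongr
    calc (2⁻¹ ^ (k + 2) * E) ^ (1 + θ) * V (t (k + 1)) ^ θ
        = ((2⁻¹ ^ (k + 2) * E) ^ θ * V (t (k + 1)) ^ θ) * (2⁻¹ ^ (k + 1 + 1) * E) := by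
          rw [ENNReal.rpow_add_of_nonneg _ _ zero_le_one hθ, ENNReal.rpow_one]
          ring
      _ = ∫⁻ x in Ico (t (k + 1)) (t (k + 1 + 1)),
            ((2⁻¹ ^ (k + 2) * E) ^ θ * V (t (k + 1)) ^ θ) * u x := by
          rw [lintegral_const_mul _ hu, ht.piece]
      _ ≤ _ := by
          refine setLIntegral_mono' measurableSet_Ico fun x hx => ?_
          simp only [F]
          rw [mul_right_comm]
          gcongr
          · rw [← ht.tail (k + 2)]
            exact lintegral_mono_set (Ioo_subset_Ioo_left hx.2.le)
          · exact hV hx.1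
  refine (ENNReal.tsum_le_tsum key).trans ?_
  rw [ENNReal.tsum_mul_left, ht.lintegral_eq_tsum F]
  gcongr 4 ^ (1 + θ) * ?_
  exact ENNReal.tsum_comp_le_tsum_of_injective (Nat.succ_injective)
    (fun k => ∫⁻ x in Ico (t k) (t (k + 1)), F x)

lemma hardy_upper {q r : ℝ} (hq : 0 < q) (hq1 : q < 1) (hr : 0 < r) (hr1 : r ≤ 1) :
    ∃ K : ℝ≥0∞, K ≠ ∞ ∧ ∀ {c b : ℝ}, c < b → ∀ {u v f : ℝ → ℝ≥0∞}, Measurable u → Measurable v →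
      Measurable f → (∀ t ∈ Ico c b, 0 < ∫⁻ s in Ioo t b, u s) → ∫⁻ s in Ioo c b, u s ≠ ∞ →
      ∫⁻ t in Ioo c b, (∫⁻ s in Ioo c t, f s ^ r * v s) ^ (q / r) * u t ≤
        K * (∫⁻ s in Ioo c b, f s) ^ q *
          (∫⁻ t in Ioo c b, (∫⁻ s in Ioo t b, u s) ^ (q / (1 - q)) * u t *
            Vr r v c t ^ (q / (1 - q))) ^ (1 - q) := by
  have hβ : 0 < q / r := div_pos hq hr
  have hq1' : 0 < 1 - q := by linarith
  set θ := q / (1 - q) with hθ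
  have hθ0 : 0 < θ := div_pos hq hq1'
  have hθ1 : (1 + θ) * (1 - q) = 1 := by rw [hθ]; field_simp; ring
  have hθ2 : θ * (1 - q) = q := by rw [hθ]; field_simp
  obtain ⟨K, hK, hHardy⟩ := discrete_hardy hβ
  refine ⟨K * (4 ^ (1 + θ)) ^ (1 - q), ENNReal.mul_ne_top hK
    (ENNReal.rpow_ne_top_of_nonneg hq1'.le (ENNReal.rpow_ne_top_of_nonneg (by positivity)
      (by simp))), ?_⟩
  intro c b hcb u v f hu hv hf hpos hfin
  obtain ⟨t, ht⟩ := exists_isDyadic hu hcb hpos hfin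
  have hV := Vr_mono_s6 hr hr1 v c
  set E := ∫⁻ s in Ioo c b, u s
  set V := Vr r v c
  set g : ℝ → ℝ≥0∞ := fun s => f s ^ r * v s
  set h : ℕ → ℝ≥0∞ := fun k => ∫⁻ s in Ico (t k) (t (k + 1)), g s
  set φ : ℕ → ℝ≥0∞ := fun k => ∫⁻ s in Ico (t k) (t (k + 1)), f s
  have hφ : ∑' k, φ k = ∫⁻ s in Ioo c b, f s := (ht.lintegral_eq_tsum f).symm
  have hh : ∀ k, h k ^ (q / r) ≤ φ k ^ q * V (t (k + 1)) ^ q := by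
    intro k
    have h1 : h k ≤ φ k ^ r * V (t (k + 1)) ^ r := by
      refine lintegral_rpow_mul_le_Vr hr hr1 hv hf ?_
      rw [← Measure.restrict_congr_set (Ioo_ae_eq_Ico (a := t k) (b := t (k + 1)))]
      exact Measure.restrict_mono (Ioo_subset_Ioo_left (ht.mem k).1) le_rfl
    calc h k ^ (q / r) ≤ (φ k ^ r * V (t (k + 1)) ^ r) ^ (q / r) := by gcongr
      _ = _ := by
        rw [ENNReal.mul_rpow_of_nonneg _ _ hβ.le, ← ENNReal.rpow_mul, ← ENNReal.rpow_mul,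
          mul_div_cancel₀ _ hr.ne']
  have hpiece : ∀ k, ∫⁻ x in Ico (t k) (t (k + 1)), (∫⁻ s in Ioo c x, g s) ^ (q / r) * u x ≤
      E * (2⁻¹ ^ k * (∑ j ∈ Finset.range (k + 1), h j) ^ (q / r)) := by
    intro k
    calc ∫⁻ x in Ico (t k) (t (k + 1)), (∫⁻ s in Ioo c x, g s) ^ (q / r) * u x
        ≤ ∫⁻ x in Ico (t k) (t (k + 1)),
            (∑ j ∈ Finset.range (k + 1), h j) ^ (q / r) * u x := by
          refine setLIntegral_mono' measurableSet_Ico fun x hx => ?_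
          gcongr
          rw [← ht.lintegral_eq_sum, ← setLIntegral_Ioo_eq_Ico]
          exact lintegral_mono_set (Ioo_subset_Ioo_right hx.2.le)
      _ = (∑ j ∈ Finset.range (k + 1), h j) ^ (q / r) * (2⁻¹ ^ (k + 1) * E) := by
          rw [lintegral_const_mul _ hu, ht.piece]
      _ ≤ (∑ j ∈ Finset.range (k + 1), h j) ^ (q / r) * (2⁻¹ ^ k * E) := by
          gcongr _ * (?_ * _)
          exact pow_le_pow_of_le_one zero_le (by simp) (Nat.le_succ k)
      _ = _ := by ring
  have hS : ∑' k, (E * (2⁻¹ ^ k * h k ^ (q / r))) ≤ (∫⁻ s in Ioo c b, f s) ^ q *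
      (∑' k, (2⁻¹ ^ k * E) ^ (1 + θ) * V (t (k + 1)) ^ θ) ^ (1 - q) := by
    rw [← hφ]
    refine le_trans (ENNReal.tsum_le_tsum fun k => ?_)
      (tsum_rpow_mul_rpow_le _ _ hq.le hq1'.le (by ring))
    rw [ENNReal.mul_rpow_of_nonneg _ _ hq1'.le, ← ENNReal.rpow_mul, ← ENNReal.rpow_mul, hθ1, hθ2,
      ENNReal.rpow_one]
    calc E * (2⁻¹ ^ k * h k ^ (q / r)) ≤ E * (2⁻¹ ^ k * (φ k ^ q * V (t (k + 1)) ^ q)) := by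
          gcongr
          exact hh k
      _ = _ := by ring
  rw [ht.lintegral_eq_tsum]
  calc ∑' k, ∫⁻ x in Ico (t k) (t (k + 1)), (∫⁻ s in Ioo c x, g s) ^ (q / r) * u x
      ≤ ∑' k, E * (2⁻¹ ^ k * (∑ j ∈ Finset.range (k + 1), h j) ^ (q / r)) :=
        ENNReal.tsum_le_tsum hpiece
    _ ≤ E * (K * ∑' k, 2⁻¹ ^ k * h k ^ (q / r)) := by
        rw [ENNReal.tsum_mul_left]
        gcongr
        exact hHardy h
    _ = K * ∑' k, (E * (2⁻¹ ^ k * h k ^ (q / r))) := by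
        rw [ENNReal.tsum_mul_left]; ring
    _ ≤ K * ((∫⁻ s in Ioo c b, f s) ^ q * (4 ^ (1 + θ) * ∫⁻ x in Ioo c b,
          (∫⁻ s in Ioo x b, u s) ^ θ * u x * V x ^ θ) ^ (1 - q)) := by
        gcongr
        refine hS.trans ?_
        gcongr
        exact ht.tsum_le_lintegral hu hV hθ0.le
    _ = _ := by
        rw [ENNReal.mul_rpow_of_nonneg _ _ hq1'.le]; ring

lemma IsDyadic.sum_test_le {q r : ℝ} (hq : 0 < q) (hr : 0 < r) (hr1 : r ≤ 1) {c b : ℝ}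
    {u v : ℝ → ℝ≥0∞} (hu : Measurable u) (hv : Measurable v) {t : ℕ → ℝ}
    (ht : IsDyadic u c b t) {C : ℝ≥0∞}
    (hC : ∀ f : ℝ → ℝ≥0∞, Measurable f →
      ∫⁻ x in Ioo c b, (∫⁻ s in Ioo c x, f s ^ r * v s) ^ (q / r) * u x ≤
        C * (∫⁻ s in Ioo c b, f s) ^ q)
    (a l : ℕ → ℝ≥0∞) (hl : ∀ k, l k < Vr r v c (t (k + 1))) (S : Finset ℕ) :
    ∑ k ∈ S, (a k * l k) ^ q * (2⁻¹ ^ (k + 2) * ∫⁻ s in Ioo c b, u s) ≤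
      C * (∑ k ∈ S, a k) ^ q := by
  choose f hf hf1 hfl using fun k => exists_test_function hr hr1 hv (hl k)
  set F : ℝ → ℝ≥0∞ := fun s => ∑ k ∈ S, a k * f k s
  have hF : Measurable F := Finset.measurable_fun_sum _ fun k _ => (hf k).const_mul _
  have hF1 : ∫⁻ s in Ioo c b, F s ≤ ∑ k ∈ S, a k := by
    refine (setLIntegral_le_lintegral _ _).trans ?_
    rw [lintegral_finsetSum _ fun k _ => (hf k).const_mul _]
    refine Finset.sum_le_sum fun k _ => ?_
    rw [lintegral_const_mul _ (hf k)]
    exact mul_le_of_le_one_right zero_le (hf1 k)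
  set G : ℝ → ℝ≥0∞ := fun x => (∫⁻ s in Ioo c x, F s ^ r * v s) ^ (q / r) * u x
  have hpiece : ∀ k ∈ S, (a k * l k) ^ q * (2⁻¹ ^ (k + 2) * ∫⁻ s in Ioo c b, u s) ≤
      ∫⁻ x in Ico (t (k + 1)) (t (k + 1 + 1)), G x := by
    intro k hk
    rw [show (2⁻¹ : ℝ≥0∞) ^ (k + 2) * ∫⁻ s in Ioo c b, u s = 2⁻¹ ^ (k + 1 + 1) *
      ∫⁻ s in Ioo c b, u s from rfl, ← ht.piece (k + 1), ← lintegral_const_mul _ hu]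
    refine setLIntegral_mono' measurableSet_Ico fun x hx => ?_
    simp only [G]
    gcongr
    calc (a k * l k) ^ q = ((a k * l k) ^ r) ^ (q / r) := by
          rw [← ENNReal.rpow_mul, mul_div_cancel₀ _ hr.ne']
      _ ≤ _ := by
          gcongr
          rw [ENNReal.mul_rpow_of_nonneg _ _ hr.le]
          calc a k ^ r * l k ^ r ≤ a k ^ r * ∫⁻ s in Ioo c (t (k + 1)), f k s ^ r * v s := by
                gcongr; exact hfl k
            _ = ∫⁻ s in Ioo c (t (k + 1)), a k ^ r * (f k s ^ r * v s) := by
                have hm : Measurable fun s => f k s ^ r * v s := ((hf k).pow_const _).mul hv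
                rw [lintegral_const_mul _ hm]
            _ ≤ ∫⁻ s in Ioo c x, a k ^ r * (f k s ^ r * v s) :=
                lintegral_mono_set (Ioo_subset_Ioo_right hx.1)
            _ ≤ _ := by
                refine lintegral_mono fun s => ?_
                rw [← mul_assoc, ← ENNReal.mul_rpow_of_nonneg _ _ hr.le]
                gcongr
                exact Finset.single_le_sum (f := fun k => a k * f k s) (fun _ _ => zero_le) hk
  calc _ ≤ ∑ k ∈ S, ∫⁻ x in Ico (t (k + 1)) (t (k + 1 + 1)), G x := Finset.sum_le_sum hpiece
    _ ≤ ∑' k, ∫⁻ x in Ico (t (k + 1)) (t (k + 1 + 1)), G x := ENNReal.sum_le_tsum _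
    _ ≤ ∫⁻ x in Ioo c b, G x := by
        rw [ht.lintegral_eq_tsum G]
        exact ENNReal.tsum_comp_le_tsum_of_injective (Nat.succ_injective)
          (fun k => ∫⁻ x in Ico (t k) (t (k + 1)), G x)
    _ ≤ C * (∫⁻ s in Ioo c b, F s) ^ q := hC F hF
    _ ≤ _ := by gcongr

lemma hardy_lower {q r : ℝ} (hq : 0 < q) (hq1 : q < 1) (hr : 0 < r) (hr1 : r ≤ 1) :
    ∃ K : ℝ≥0∞, K ≠ ∞ ∧ ∀ {c b : ℝ}, c < b → ∀ {u v : ℝ → ℝ≥0∞}, Measurable u → Measurable v →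
      (∀ s ∈ Ioo c b, 0 < v s) → (∀ t ∈ Ico c b, 0 < ∫⁻ s in Ioo t b, u s) →
      ∫⁻ s in Ioo c b, u s ≠ ∞ → ∀ {C : ℝ≥0∞}, C ≠ ∞ →
      (∀ f : ℝ → ℝ≥0∞, Measurable f →
        ∫⁻ x in Ioo c b, (∫⁻ s in Ioo c x, f s ^ r * v s) ^ (q / r) * u x ≤
          C * (∫⁻ s in Ioo c b, f s) ^ q) →
      (∫⁻ t in Ioo c b, (∫⁻ s in Ioo t b, u s) ^ (q / (1 - q)) * u t *
        Vr r v c t ^ (q / (1 - q))) ^ (1 - q) ≤ K * C := by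
  have hq1' : 0 < 1 - q := by linarith
  set θ := q / (1 - q) with hθ
  have hθ0 : 0 < θ := div_pos hq hq1'
  have hθ1 : (1 + θ) * (1 - q) = 1 := by rw [hθ]; field_simp; ring
  have hθ2 : θ * (1 - q) = q := by rw [hθ]; field_simp
  have hθ3 : (1 + θ) * q = θ := by rw [hθ]; field_simp; ring
  have hθ4 : θ * q + q = θ := by rw [hθ]; field_simp; ring
  refine ⟨(2 ^ θ) ^ (1 - q) * 4, ENNReal.mul_ne_top (ENNReal.rpow_ne_top_of_nonneg hq1'.le
    (ENNReal.rpow_ne_top_of_nonneg hθ0.le (by simp))) (by simp), ?_⟩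
  intro c b hcb u v hu hv hvpos hpos hfin C hCt hC
  obtain ⟨t, ht⟩ := exists_isDyadic hu hcb hpos hfin
  have hV := Vr_mono_s6 hr hr1 v c
  have htest := ht.sum_test_le hq hr hr1 hu hv hC
  have hVpos : ∀ k, 0 < Vr r v c (t (k + 1)) := by
    intro k
    refine Vr_pos hr hr1 hv ?_ fun s hs => hvpos s ⟨hs.1, hs.2.trans (ht.mem _).2⟩
    exact (ht.mem 0).1.trans_lt (ht.strictMono (Nat.succ_pos k))
  have hE0 : ∫⁻ s in Ioo c b, u s ≠ 0 := (hpos c ⟨le_rfl, hcb⟩).ne'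
  have hint := ht.lintegral_le_tsum hu hV hθ0.le
  set E := ∫⁻ s in Ioo c b, u s
  set V := Vr r v c
  have he0 : ∀ k : ℕ, (2⁻¹ : ℝ≥0∞) ^ k * E ≠ 0 := fun k =>
    mul_ne_zero (pow_ne_zero _ (by simp)) hE0
  have het : ∀ k : ℕ, (2⁻¹ : ℝ≥0∞) ^ k * E ≠ ∞ := fun k =>
    ENNReal.mul_ne_top (ENNReal.pow_ne_top (by simp)) hfin
  have hVt : ∀ k, V (t (k + 1)) ≠ ∞ := by
    intro k
    have hb : V (t (k + 1)) ≤ (C / (2⁻¹ ^ (k + 2) * E)) ^ (1 / q) := by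
      refine le_of_forall_lt fun x hx => ?_
      obtain ⟨y, hxy, hy⟩ := exists_between hx
      refine hxy.trans_le ?_
      have := htest (fun _ => 1) (fun j => if j = k then y else 0) (fun j => by
        by_cases h : j = k
        · simp only [h, if_true]; exact hy
        · simp only [h, if_false]; exact hVpos j) {k}
      simp only [Finset.sum_singleton, if_true, one_mul, ENNReal.one_rpow, mul_one] at this
      rw [one_div, ENNReal.le_rpow_inv_iff hq]
      exact (ENNReal.le_div_iff_mul_le (Or.inl (he0 _)) (Or.inl (het _))).2 this
    exact ne_top_of_le_ne_top (ENNReal.rpow_ne_top_of_nonneg (by positivity)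
      (ENNReal.div_ne_top hCt (he0 _))) hb
  set a : ℕ → ℝ≥0∞ := fun k => (2⁻¹ ^ k * E) ^ (1 + θ) * (V (t (k + 1)) / 2) ^ θ
  have hat : ∀ k, a k ≠ ∞ := fun k => ENNReal.mul_ne_top
    (ENNReal.rpow_ne_top_of_nonneg (by positivity) (het k))
    (ENNReal.rpow_ne_top_of_nonneg hθ0.le (ENNReal.div_ne_top (hVt k) (by simp)))
  have haS : ∀ S : Finset ℕ, (∑ k ∈ S, a k) ^ (1 - q) ≤ 4 * C := by
    intro S
    have h1 := htest a (fun k => V (t (k + 1)) / 2)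
      (fun k => ENNReal.half_lt_self (hVpos k).ne' (hVt k)) S
    have h2 : ∀ k, a k = 4 * ((a k * (V (t (k + 1)) / 2)) ^ q * (2⁻¹ ^ (k + 2) * E)) := by
      intro k
      rw [mul_left_comm, ← inv_two_pow_mul_eq k E]
      simp only [a]
      rw [ENNReal.mul_rpow_of_nonneg _ _ hq.le, ENNReal.mul_rpow_of_nonneg _ _ hq.le,
        ← ENNReal.rpow_mul, ← ENNReal.rpow_mul, hθ3, mul_assoc (_ ^ θ),
        ← ENNReal.rpow_add_of_nonneg _ _ (by positivity) hq.le, hθ4,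
        ENNReal.rpow_add_of_nonneg _ _ zero_le_one hθ0.le, ENNReal.rpow_one]
      ring
    have h3 : ∑ k ∈ S, a k ≤ 4 * C * (∑ k ∈ S, a k) ^ q := by
      calc ∑ k ∈ S, a k = 4 * ∑ k ∈ S, (a k * (V (t (k + 1)) / 2)) ^ q * (2⁻¹ ^ (k + 2) * E) := by
            rw [Finset.mul_sum]
            exact Finset.sum_congr rfl fun k _ => h2 k
        _ ≤ _ := by rw [mul_assoc]; gcongr
    rcases eq_or_ne (∑ k ∈ S, a k) 0 with h0 | h0
    · rw [h0, ENNReal.zero_rpow_of_pos hq1']; exact zero_le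
    · have hSt : ∑ k ∈ S, a k ≠ ∞ := ENNReal.sum_ne_top.2 fun k _ => hat k
      rw [ENNReal.rpow_sub _ _ h0 hSt, ENNReal.rpow_one]
      exact ENNReal.div_le_of_le_mul h3
  have haT : (∑' k, a k) ^ (1 - q) ≤ 4 * C := by
    rw [← ENNReal.le_rpow_inv_iff hq1', ENNReal.tsum_eq_iSup_sum]
    exact iSup_le fun S => (ENNReal.le_rpow_inv_iff hq1').2 (haS S)
  have hsum : ∑' k, (2⁻¹ ^ k * E) ^ (1 + θ) * V (t (k + 1)) ^ θ = 2 ^ θ * ∑' k, a k := by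
    rw [← ENNReal.tsum_mul_left]
    refine tsum_congr fun k => ?_
    simp only [a]
    rw [mul_left_comm, ← ENNReal.mul_rpow_of_nonneg _ _ hθ0.le,
      ENNReal.mul_div_cancel (by simp) (by simp)]
  calc _ ≤ (2 ^ θ * ∑' k, a k) ^ (1 - q) := by
        rw [← hsum]; gcongr
    _ = (2 ^ θ) ^ (1 - q) * (∑' k, a k) ^ (1 - q) := ENNReal.mul_rpow_of_nonneg _ _ hq1'.le
    _ ≤ _ := by rw [mul_assoc]; gcongr

lemma setLIntegral_Ioo_pos {g : ℝ → ℝ≥0∞} (hg : Measurable g) {c d : ℝ} (hcd : c < d)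
    (hpos : ∀ s ∈ Ioo c d, 0 < g s) : 0 < ∫⁻ s in Ioo c d, g s := by
  rw [setLIntegral_pos_iff hg, inter_eq_right.2
    (show Ioo c d ⊆ Function.support g from fun s hs => (hpos s hs).ne')]
  simpa using hcd

lemma CesCesIneq.hardy {a b r p q : ℝ} {u v w : ℝ → ℝ≥0∞} {C : ℝ≥0∞} (hp : 0 < p) (hq : 0 < q)
    (hr : 0 < r) (hw : Measurable w) (hC : CesCesIneq a b r p q u v w C) {x : ℝ}
    (hx : x ∈ Ioo a b) {f : ℝ → ℝ≥0∞} (hf : Measurable f) :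
    ∫⁻ t in Ioo x b, (∫⁻ s in Ioo x t, f s ^ r * v s) ^ (q / r) * u t ≤
      (C * (∫⁻ t in Ioo x b, w t) ^ (1 / p)) ^ q * (∫⁻ s in Ioo x b, f s) ^ q := by
  have hβ : 0 < q / r := div_pos hq hr
  set F : ℝ → ℝ≥0∞ := (Ioo x b).indicator f
  have h1 := hC F (hf.indicator measurableSet_Ioo)
  rw [one_div q, ENNReal.rpow_inv_le_iff hq] at h1
  have hL : ∫⁻ t in Ioo x b, (∫⁻ s in Ioo x t, f s ^ r * v s) ^ (q / r) * u t ≤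
      ∫⁻ t in Ioo a b, (∫⁻ s in Ioo a t, F s ^ r * v s) ^ (q / r) * u t := by
    refine le_trans (setLIntegral_mono' measurableSet_Ioo fun t ht => ?_)
      (lintegral_mono_set (Ioo_subset_Ioo_left hx.1.le))
    gcongr ?_ ^ _ * _
    refine le_trans (setLIntegral_mono' measurableSet_Ioo fun s hs => ?_)
      (lintegral_mono_set (Ioo_subset_Ioo_left hx.1.le))
    simp only [F]
    rw [indicator_of_mem (show s ∈ Ioo x b from ⟨hs.1, hs.2.trans ht.2⟩)]
  have hR : ∫⁻ t in Ioo a b, (∫⁻ s in Ioo a t, F s) ^ p * w t ≤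
      (∫⁻ s in Ioo x b, f s) ^ p * ∫⁻ t in Ioo x b, w t := by
    rw [← lintegral_const_mul _ hw, ← lintegral_indicator measurableSet_Ioo,
      ← lintegral_indicator measurableSet_Ioo]
    refine lintegral_mono_ae ?_
    filter_upwards [Measure.ae_ne volume x] with t htx
    by_cases ht : t ∈ Ioo a b
    · rw [indicator_of_mem ht]
      rcases lt_or_gt_of_ne htx with h | h
      · have h0 : ∫⁻ s in Ioo a t, F s = 0 := by
          rw [setLIntegral_congr_fun (g := fun _ => 0) measurableSet_Ioo, lintegral_zero]
          intro s hs
          exact indicator_of_notMem (fun h' => absurd (h'.1.trans hs.2) (not_lt.2 h.le)) _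
        rw [h0, ENNReal.zero_rpow_of_pos hp, zero_mul]
        exact zero_le
      · rw [indicator_of_mem (show t ∈ Ioo x b from ⟨h, ht.2⟩)]
        gcongr ?_ ^ _ * _
        refine (setLIntegral_le_lintegral _ _).trans ?_
        rw [lintegral_indicator measurableSet_Ioo]
    · rw [indicator_of_notMem ht]
      exact zero_le
  calc _ ≤ _ := hL
    _ ≤ _ := h1
    _ ≤ (C * ((∫⁻ s in Ioo x b, f s) ^ p * ∫⁻ t in Ioo x b, w t) ^ (1 / p)) ^ q := by gcongr
    _ = _ := by
      rw [ENNReal.mul_rpow_of_nonneg _ _ (by positivity : 0 ≤ 1 / p), ← ENNReal.rpow_mul,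
        mul_one_div_cancel hp.ne', ENNReal.rpow_one, ← ENNReal.mul_rpow_of_nonneg _ _ hq.le]
      congr 1
      ring

lemma CesCesIneq.tail_ne_top {a b r p q : ℝ} {u v w : ℝ → ℝ≥0∞} {C : ℝ≥0∞} (hp : 0 < p)
    (hq : 0 < q) (hr : 0 < r) (hr1 : r ≤ 1) (hu : Measurable u) (hv : Measurable v)
    (hw : Measurable w)
    (hvpos : ∀ s ∈ Ioo a b, 0 < v s) (hWt : ∀ x ∈ Ioo a b, ∫⁻ t in Ioo x b, w t ≠ ∞)
    (hCt : C ≠ ∞) (hC : CesCesIneq a b r p q u v w C) {c : ℝ} (hc : c ∈ Ioo a b) :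
    ∫⁻ s in Ioo c b, u s ≠ ∞ := by
  obtain ⟨x, hax, hxc⟩ := exists_between hc.1
  have hx : x ∈ Ioo a b := ⟨hax, hxc.trans hc.2⟩
  have hV : 0 < Vr r v x c :=
    Vr_pos hr hr1 hv hxc fun s hs => hvpos s ⟨hax.trans hs.1, hs.2.trans hc.2⟩
  obtain ⟨l, hl0, hl⟩ := exists_between hV
  obtain ⟨f, hf, hf1, hfl⟩ := exists_test_function hr hr1 hv hl
  have h := hC.hardy hp hq hr hw hx hf
  have hlow : l ^ q * ∫⁻ s in Ioo c b, u s ≤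
      ∫⁻ t in Ioo x b, (∫⁻ s in Ioo x t, f s ^ r * v s) ^ (q / r) * u t := by
    rw [← lintegral_const_mul _ hu]
    refine le_trans (setLIntegral_mono' measurableSet_Ioo fun t ht => ?_)
      (lintegral_mono_set (Ioo_subset_Ioo_left hxc.le))
    gcongr
    calc l ^ q = (l ^ r) ^ (q / r) := by rw [← ENNReal.rpow_mul, mul_div_cancel₀ _ hr.ne']
      _ ≤ _ := by
        gcongr
        exact hfl.trans (lintegral_mono_set (Ioo_subset_Ioo_right ht.1.le))
  have hup : (C * (∫⁻ t in Ioo x b, w t) ^ (1 / p)) ^ q * (∫⁻ s in Ioo x b, f s) ^ q ≠ ∞ := by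
    refine ENNReal.mul_ne_top (ENNReal.rpow_ne_top_of_nonneg hq.le (ENNReal.mul_ne_top hCt
      (ENNReal.rpow_ne_top_of_nonneg (by positivity) (hWt x hx))))
      (ENNReal.rpow_ne_top_of_nonneg hq.le ?_)
    exact ne_top_of_le_ne_top ENNReal.one_ne_top ((setLIntegral_le_lintegral _ _).trans hf1)
  intro htop
  refine ne_top_of_le_ne_top hup (hlow.trans h) ?_
  rw [htop, ENNReal.mul_top]
  exact (ENNReal.rpow_pos hl0 (ne_top_of_lt hl)).ne'

lemma C₂_le_of_CesCesIneq {p q r : ℝ} (hp : 0 < p) (hq : 0 < q) (hq1 : q < 1) (hr : 0 < r)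
    (hr1 : r ≤ 1) : ∃ K : ℝ≥0∞, K ≠ ∞ ∧ K ≠ 0 ∧ ∀ {a b : ℝ} {u v w : ℝ → ℝ≥0∞},
      IsWeight a b u → IsWeight a b v → IsWeight a b w →
      (∀ x ∈ Ioo a b, 0 < (∫⁻ t in Ioo x b, w t) ∧ (∫⁻ t in Ioo x b, w t) < ∞) →
      ∀ {C : ℝ≥0∞}, CesCesIneq a b r p q u v w C → C₂ a b r p q u v w ≤ K * C := by
  obtain ⟨K, hK, hlow⟩ := hardy_lower hq hq1 hr hr1
  refine ⟨K ^ (1 / q) + 1, ENNReal.add_ne_top.2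
    ⟨ENNReal.rpow_ne_top_of_nonneg (by positivity) hK, by simp⟩, by simp, ?_⟩
  intro a b u v w hu hv hw hW C hC
  rcases eq_or_ne C ∞ with rfl | hCt
  · rw [ENNReal.mul_top (by simp)]; exact le_top
  refine iSup₂_le fun x hx => ?_
  have hW0 := (hW x hx).1.ne'
  have hWt := (hW x hx).2.ne
  set W := ∫⁻ t in Ioo x b, w t
  have hD := hlow hx.2 hu.1 hv.1 (fun s hs => (hv.2 s ⟨hx.1.trans hs.1, hs.2⟩).1)
    (fun t ht => setLIntegral_Ioo_pos hu.1 ht.2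
      fun s hs => (hu.2 s ⟨hx.1.trans (ht.1.trans_lt hs.1), hs.2⟩).1)
    (hC.tail_ne_top hp hq hr hr1 hu.1 hv.1 hw.1 (fun s hs => (hv.2 s hs).1)
      (fun x hx => (hW x hx).2.ne) hCt hx)
    (C := (C * W ^ (1 / p)) ^ q)
    (ENNReal.rpow_ne_top_of_nonneg hq.le (ENNReal.mul_ne_top hCt
      (ENNReal.rpow_ne_top_of_nonneg (by positivity) hWt)))
    (fun f hf => hC.hardy hp hq hr hw.1 hx hf)
  set I := ∫⁻ t in Ioo x b, (∫⁻ s in Ioo t b, u s) ^ (q / (1 - q)) * u t *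
    Vr r v x t ^ (q / (1 - q))
  calc W ^ (-(1 / p)) * I ^ ((1 - q) / q) = W ^ (-(1 / p)) * (I ^ (1 - q)) ^ (1 / q) := by
        rw [← ENNReal.rpow_mul, mul_one_div]
    _ ≤ W ^ (-(1 / p)) * (K * (C * W ^ (1 / p)) ^ q) ^ (1 / q) := by gcongr
    _ = (W ^ (-(1 / p)) * W ^ (1 / p)) * (K ^ (1 / q) * C) := by
        rw [ENNReal.mul_rpow_of_nonneg _ _ (by positivity : 0 ≤ 1 / q), ← ENNReal.rpow_mul,
          mul_one_div_cancel hq.ne', ENNReal.rpow_one]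
        ring
    _ = K ^ (1 / q) * C := by
        rw [← ENNReal.rpow_add _ _ hW0 hWt, neg_add_cancel, ENNReal.rpow_zero, one_mul]
    _ ≤ _ := by gcongr; exact le_self_add

lemma tail_ne_top_of_C₂_ne_top {a b r p q : ℝ} {u v w : ℝ → ℝ≥0∞} (hp : 0 < p) (hq : 0 < q)
    (hq1 : q < 1) (hr : 0 < r) (hr1 : r ≤ 1) (hu : IsWeight a b u) (hv : IsWeight a b v)
    (hWt : ∀ x ∈ Ioo a b, ∫⁻ t in Ioo x b, w t ≠ ∞)
    (hC : C₂ a b r p q u v w ≠ ∞) {c : ℝ} (hc : c ∈ Ioo a b) : ∫⁻ s in Ioo c b, u s ≠ ∞ := by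
  intro htop
  refine hC ?_
  have hq1' : 0 < 1 - q := by linarith
  have hθ : 0 < q / (1 - q) := div_pos hq hq1'
  obtain ⟨x, hax, hxc⟩ := exists_between hc.1
  have hx : x ∈ Ioo a b := ⟨hax, hxc.trans hc.2⟩
  have hI : ∫⁻ t in Ioo x b, (∫⁻ s in Ioo t b, u s) ^ (q / (1 - q)) * u t *
      Vr r v x t ^ (q / (1 - q)) = ∞ := by
    rw [eq_top_iff]
    calc ∞ = ∫⁻ t in Ioo x c, (∞ : ℝ≥0∞) := by simp [hxc]
      _ ≤ ∫⁻ t in Ioo x c, (∫⁻ s in Ioo t b, u s) ^ (q / (1 - q)) * u t *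
          Vr r v x t ^ (q / (1 - q)) := by
        refine setLIntegral_mono' measurableSet_Ioo fun t ht => ?_
        have h1 : ∫⁻ s in Ioo t b, u s = ∞ := by
          rw [eq_top_iff, ← htop]
          exact lintegral_mono_set (Ioo_subset_Ioo_left ht.2.le)
        have h2 : Vr r v x t ^ (q / (1 - q)) ≠ 0 := by
          rw [Ne, ENNReal.rpow_eq_zero_iff_of_pos hθ]
          exact (Vr_pos hr hr1 hv.1 ht.1 fun s hs =>
            (hv.2 s ⟨hax.trans hs.1, hs.2.trans (ht.2.trans hc.2)⟩).1).ne'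
        rw [h1, ENNReal.top_rpow_of_pos hθ,
          ENNReal.top_mul (hu.2 t ⟨hax.trans ht.1, ht.2.trans hc.2⟩).1.ne', ENNReal.top_mul h2]
      _ ≤ _ := lintegral_mono_set (Ioo_subset_Ioo_right hc.2.le)
  rw [eq_top_iff]
  refine le_trans ?_ (le_iSup₂ (f := fun x _ => (∫⁻ t in Ioo x b, w t) ^ (-(1 / p)) *
    (∫⁻ t in Ioo x b, (∫⁻ s in Ioo t b, u s) ^ (q / (1 - q)) * u t *
      Vr r v x t ^ (q / (1 - q))) ^ ((1 - q) / q)) x hx)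
  rw [hI, ENNReal.top_rpow_of_pos (div_pos hq1' hq), ENNReal.mul_top]
  rw [Ne, ENNReal.rpow_eq_zero_iff]
  rintro (⟨h0, h1⟩ | ⟨h0, h1⟩)
  · have : 0 < 1 / p := by positivity
    linarith
  · exact hWt x hx h0

lemma lintegral_le_of_forall_left {a b β : ℝ} (hab : a < b) (hβ : 0 < β) {u : ℝ → ℝ≥0∞}
    (hu : Measurable u) (g : ℝ → ℝ≥0∞) {M : ℝ≥0∞}
    (h : ∀ c ∈ Ioo a b, ∫⁻ t in Ioo c b, (∫⁻ s in Ioo c t, g s) ^ β * u t ≤ M) :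
    ∫⁻ t in Ioo a b, (∫⁻ s in Ioo a t, g s) ^ β * u t ≤ M := by
  obtain ⟨c, hc, hcab, hclim⟩ := exists_seq_strictAnti_tendsto' hab
  have hU : ∀ t, ⋃ n, Ioo (c n) t = Ioo a t := by
    intro t
    refine Subset.antisymm (iUnion_subset fun n => Ioo_subset_Ioo_left (hcab n).1.le) ?_
    intro s hs
    obtain ⟨n, hn⟩ := (hclim.eventually (gt_mem_nhds hs.1)).exists
    exact mem_iUnion.2 ⟨n, hn, hs.2⟩
  have hsup : ∀ t, (∫⁻ s in Ioo a t, g s) ^ β * u t =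
      ⨆ n, (∫⁻ s in Ioo (c n) t, g s) ^ β * u t := by
    intro t
    rw [← hU t, setLIntegral_iUnion_of_directed, ← ENNReal.iSup_mul]
    · congr 1
      exact (ENNReal.orderIsoRpow β hβ).map_iSup _
    · exact directed_of_isDirected_le fun m n hmn => Ioo_subset_Ioo_left (hc.antitone hmn)
  simp_rw [hsup]
  rw [lintegral_iSup]
  · refine iSup_le fun n => ?_
    refine le_trans ?_ (h (c n) (hcab n))
    rw [← lintegral_indicator measurableSet_Ioo, ← lintegral_indicator measurableSet_Ioo]
    refine lintegral_mono fun t => ?_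
    by_cases ht : t ∈ Ioo a b
    · rw [indicator_of_mem ht]
      rcases le_or_gt t (c n) with h' | h'
      · simp [Ioo_eq_empty_of_le h', ENNReal.zero_rpow_of_pos hβ]
      · rw [indicator_of_mem (show t ∈ Ioo (c n) b from ⟨h', ht.2⟩)]
    · rw [indicator_of_notMem ht]
      exact zero_le
  · exact fun n => ((measurable_primitive _ g).pow_const _).mul hu
  · intro m n hmn t
    simp only
    gcongr
    exact hc.antitone hmn

lemma IsDyadic.rpow_lintegral_le_tsum {g : ℝ → ℝ≥0∞} {c b : ℝ} {x : ℕ → ℝ}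
    (hx : IsDyadic g c b x) {p q r : ℝ} (hp : 0 < p) (hpq : p ≤ q) (hpr : p ≤ r)
    {u h : ℝ → ℝ≥0∞} (hu : Measurable u) :
    (∫⁻ t in Ioo c b, (∫⁻ s in Ioo c t, h s) ^ (q / r) * u t) ^ (p / q) ≤
      ∑' k, (∫⁻ t in Ioo c b, (∫⁻ s in Ico (x k) (x (k + 1)), (Iio t).indicator h s) ^ (q / r) *
        u t) ^ (p / q) := by
  have hq : 0 < q := hp.trans_le hpq
  have hr : 0 < r := hp.trans_le hpr
  set A : ℕ → ℝ → ℝ≥0∞ := fun k t => ∫⁻ s in Ico (x k) (x (k + 1)), (Iio t).indicator h s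
  have hA : ∀ k, Measurable (A k) := fun k => Monotone.measurable fun t t' htt' =>
    lintegral_mono (indicator_le_indicator_of_subset (Iio_subset_Iio htt') (fun _ => zero_le))
  have hAr : ∀ (k : ℕ) {e : ℝ}, Measurable fun t => A k t ^ e := fun k e => (hA k).pow_const e
  set μ := (volume.restrict (Ioo c b)).withDensity u
  have hμ : ∀ {φ : ℝ → ℝ≥0∞}, Measurable φ →
      ∫⁻ t, φ t ∂μ = ∫⁻ t in Ioo c b, φ t * u t := by
    intro φ hφ
    rw [lintegral_withDensity_eq_lintegral_mul _ hu hφ]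
    simp only [Pi.mul_apply, mul_comm]
  have hsum : ∀ t ∈ Ioo c b, ∫⁻ s in Ioo c t, h s = ∑' k, A k t := by
    intro t ht
    rw [← hx.lintegral_eq_tsum, lintegral_indicator measurableSet_Iio,
      Measure.restrict_restrict measurableSet_Iio]
    congr 3
    ext s
    simp only [mem_Ioo, mem_inter_iff, mem_Iio]
    exact ⟨fun hs => ⟨hs.2, hs.1, hs.2.trans ht.2⟩, fun hs => ⟨hs.2.1, hs.1⟩⟩
  calc (∫⁻ t in Ioo c b, (∫⁻ s in Ioo c t, h s) ^ (q / r) * u t) ^ (p / q)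
      ≤ (∫⁻ t in Ioo c b, (∑' k, A k t ^ (p / r)) ^ (q / p) * u t) ^ (p / q) := by
        refine ENNReal.rpow_le_rpow (setLIntegral_mono' measurableSet_Ioo fun t ht => ?_)
          (by positivity)
        rw [hsum t ht, show q / r = p / r * (q / p) by field_simp, ENNReal.rpow_mul]
        gcongr ?_ ^ _ * _
        exact tsum_rpow_le _ (by positivity) ((div_le_one hr).2 hpr)
    _ = (∫⁻ t, (∑' k, A k t ^ (p / r)) ^ (q / p) ∂μ) ^ (1 / (q / p)) := by
        rw [hμ ((Measurable.tsum fun k => hAr k).pow_const _), one_div_div]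
    _ ≤ ∑' k, (∫⁻ t, (A k t ^ (p / r)) ^ (q / p) ∂μ) ^ (1 / (q / p)) :=
        lintegral_tsum_rpow_le_s6 (fun k => hAr k) ((one_le_div hp).2 hpq)
    _ = _ := by
        refine tsum_congr fun k => ?_
        rw [hμ ((hAr k).pow_const _), one_div_div]
        simp_rw [← ENNReal.rpow_mul]
        rw [show p / r * (q / p) = q / r by field_simp]

lemma IsDyadic.tsum_rpow_mul_tail_le {w : ℝ → ℝ≥0∞} {a b c : ℝ} {x : ℕ → ℝ}
    (hx : IsDyadic w c b x) (hc : c ∈ Ioo a b) {p : ℝ} (hp : 0 < p) (hw : Measurable w)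
    (f : ℝ → ℝ≥0∞) :
    ∑' k, (∫⁻ s in Ico (x k) (x (k + 1)), f s) ^ p * ∫⁻ s in Ioo (x k) b, w s ≤
      4 * ∫⁻ t in Ioo a b, (∫⁻ s in Ioo a t, f s) ^ p * w t := by
  set F : ℝ → ℝ≥0∞ := fun t => (∫⁻ s in Ioo a t, f s) ^ p * w t
  have hxa : ∀ k, a < x k := fun k => hc.1.trans_le (hx.mem k).1
  have key : ∀ k, (∫⁻ s in Ico (x k) (x (k + 1)), f s) ^ p * ∫⁻ s in Ioo (x k) b, w s ≤
      4 * ∫⁻ t in Ico (x (k + 1)) (x (k + 1 + 1)), F t := by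
    intro k
    rw [hx.tail, inv_two_pow_mul_eq, ← hx.piece (k + 1), mul_left_comm,
      ← lintegral_const_mul _ hw]
    gcongr 4 * ?_
    refine setLIntegral_mono' measurableSet_Ico fun t ht => ?_
    simp only [F]
    gcongr ?_ ^ _ * _
    exact lintegral_mono_set fun s hs => ⟨(hxa k).trans_le hs.1, hs.2.trans_le ht.1⟩
  calc _ ≤ ∑' k, 4 * ∫⁻ t in Ico (x (k + 1)) (x (k + 1 + 1)), F t := ENNReal.tsum_le_tsum key
    _ = 4 * ∑' k, ∫⁻ t in Ico (x (k + 1)) (x (k + 1 + 1)), F t := ENNReal.tsum_mul_left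
    _ ≤ 4 * ∑' k, ∫⁻ t in Ico (x k) (x (k + 1)), F t := by
        gcongr 4 * ?_
        exact ENNReal.tsum_comp_le_tsum_of_injective Nat.succ_injective
          fun k => ∫⁻ t in Ico (x k) (x (k + 1)), F t
    _ = 4 * ∫⁻ t in Ioo c b, F t := by rw [hx.lintegral_eq_tsum]
    _ ≤ _ := by
        gcongr 4 * ?_
        exact lintegral_mono_set (Ioo_subset_Ioo_left hc.1.le)

lemma lintegral_block_le {p q r : ℝ} (hp : 0 < p) (hq : 0 < q) (hq1 : q < 1) (hr : 0 < r)
    (hr1 : r ≤ 1) : ∃ K : ℝ≥0∞, K ≠ ∞ ∧ ∀ {a b : ℝ} {u v w : ℝ → ℝ≥0∞},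
      IsWeight a b u → IsWeight a b v →
      (∀ x ∈ Ioo a b, 0 < (∫⁻ t in Ioo x b, w t) ∧ (∫⁻ t in Ioo x b, w t) < ∞) →
      C₂ a b r p q u v w ≠ ∞ → ∀ {c x y : ℝ}, c ≤ x → x ∈ Ioo a b → ∀ {f : ℝ → ℝ≥0∞},
      Measurable f →
      (∫⁻ t in Ioo c b, (∫⁻ s in Ico x y, (Iio t).indicator (fun s => f s ^ r * v s) s) ^ (q / r) *
        u t) ^ (p / q) ≤ K * C₂ a b r p q u v w ^ p *
          ((∫⁻ s in Ico x y, f s) ^ p * ∫⁻ s in Ioo x b, w s) := by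
  obtain ⟨K, hK, hup⟩ := hardy_upper hq hq1 hr hr1
  have hβ : 0 < q / r := div_pos hq hr
  refine ⟨K ^ (p / q), ENNReal.rpow_ne_top_of_nonneg (by positivity) hK, ?_⟩
  intro a b u v w hu hv hW hC c x y hcx hx f hf
  set φ := ∫⁻ s in Ico x y, f s
  set h : ℝ → ℝ≥0∞ := (Ico x y).indicator f
  set I := ∫⁻ t in Ioo x b, (∫⁻ s in Ioo t b, u s) ^ (q / (1 - q)) * u t *
    Vr r v x t ^ (q / (1 - q))
  have hφ : ∫⁻ s in Ioo x b, h s ≤ φ := by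
    refine (setLIntegral_le_lintegral _ _).trans ?_
    rw [lintegral_indicator measurableSet_Ico]
  have hCx : (∫⁻ t in Ioo x b, w t) ^ (-(1 / p)) * I ^ ((1 - q) / q) ≤ C₂ a b r p q u v w :=
    le_iSup₂ (f := fun x _ => (∫⁻ t in Ioo x b, w t) ^ (-(1 / p)) *
      (∫⁻ t in Ioo x b, (∫⁻ s in Ioo t b, u s) ^ (q / (1 - q)) * u t *
        Vr r v x t ^ (q / (1 - q))) ^ ((1 - q) / q)) x hx
  have hfin := tail_ne_top_of_C₂_ne_top hp hq hq1 hr hr1 hu hv (fun x hx => (hW x hx).2.ne) hC hx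
  have hW0 := (hW x hx).1.ne'
  have hWt := (hW x hx).2.ne
  set W := ∫⁻ t in Ioo x b, w t
  set D := C₂ a b r p q u v w
  have hI : I ^ ((1 - q) / q) ≤ W ^ (1 / p) * D := by
    calc I ^ ((1 - q) / q) = W ^ (1 / p) * (W ^ (-(1 / p)) * I ^ ((1 - q) / q)) := by
          rw [← mul_assoc, ← ENNReal.rpow_add _ _ hW0 hWt, add_neg_cancel, ENNReal.rpow_zero,
            one_mul]
      _ ≤ _ := by gcongr
  have hB : ∫⁻ t in Ioo c b, (∫⁻ s in Ico x y, (Iio t).indicator (fun s => f s ^ r * v s) s) ^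
      (q / r) * u t ≤ ∫⁻ t in Ioo x b, (∫⁻ s in Ioo x t, h s ^ r * v s) ^ (q / r) * u t := by
    rw [← lintegral_indicator measurableSet_Ioo, ← lintegral_indicator measurableSet_Ioo]
    refine lintegral_mono fun t => ?_
    by_cases ht : t ∈ Ioo c b
    · rw [indicator_of_mem ht]
      rcases le_or_gt t x with htx | htx
      · rw [setLIntegral_congr_fun (g := fun _ => (0 : ℝ≥0∞)) measurableSet_Ico, lintegral_zero,
          ENNReal.zero_rpow_of_pos hβ, zero_mul]
        · exact zero_le
        · intro s hs
          exact indicator_of_notMem (show s ∉ Iio t from not_lt.2 (htx.trans hs.1)) _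
      · rw [indicator_of_mem (show t ∈ Ioo x b from ⟨htx, ht.2⟩)]
        gcongr ?_ ^ _ * _
        rw [setLIntegral_Ioo_eq_Ico, ← lintegral_indicator measurableSet_Ico,
          ← lintegral_indicator measurableSet_Ico]
        refine lintegral_mono fun s => ?_
        by_cases hs : s ∈ Ico x y
        · rw [indicator_of_mem hs]
          by_cases hst : s < t
          · rw [indicator_of_mem (show s ∈ Iio t from hst),
              indicator_of_mem (show s ∈ Ico x t from ⟨hs.1, hst⟩)]
            simp only [h]
            rw [indicator_of_mem hs]
          · rw [indicator_of_notMem (show s ∉ Iio t from hst)]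
            exact zero_le
        · rw [indicator_of_notMem hs]
          exact zero_le
    · rw [indicator_of_notMem ht]
      exact zero_le
  have hB' := hup hx.2 hu.1 hv.1 (f := h) (hf.indicator measurableSet_Ico)
    (fun t ht => setLIntegral_Ioo_pos hu.1 ht.2
      fun s hs => (hu.2 s ⟨hx.1.trans (ht.1.trans_lt hs.1), hs.2⟩).1) hfin
  calc _ ≤ (K * φ ^ q * I ^ (1 - q)) ^ (p / q) := by
        refine ENNReal.rpow_le_rpow (hB.trans (hB'.trans ?_)) (by positivity)
        gcongr
    _ = K ^ (p / q) * φ ^ p * (I ^ ((1 - q) / q)) ^ p := by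
        rw [ENNReal.mul_rpow_of_nonneg _ _ (by positivity),
          ENNReal.mul_rpow_of_nonneg _ _ (by positivity), ← ENNReal.rpow_mul, ← ENNReal.rpow_mul,
          ← ENNReal.rpow_mul, mul_div_cancel₀ _ hq.ne', show (1 - q) * (p / q) = (1 - q) / q * p by
            ring]
    _ ≤ K ^ (p / q) * φ ^ p * (W ^ (1 / p) * D) ^ p := by gcongr
    _ = _ := by
        rw [ENNReal.mul_rpow_of_nonneg _ _ hp.le, ← ENNReal.rpow_mul, one_div_mul_cancel hp.ne',
          ENNReal.rpow_one]
        ring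

lemma exists_CesCesIneq {p q r : ℝ} (hp : 0 < p) (hpq : p ≤ q) (hq1 : q < 1) (hpr : p ≤ r)
    (hr1 : r ≤ 1) : ∃ K : ℝ≥0∞, K ≠ ∞ ∧ K ≠ 0 ∧ ∀ {a b : ℝ}, a < b → ∀ {u v w : ℝ → ℝ≥0∞},
      IsWeight a b u → IsWeight a b v → IsWeight a b w →
      (∀ x ∈ Ioo a b, 0 < (∫⁻ t in Ioo x b, w t) ∧ (∫⁻ t in Ioo x b, w t) < ∞) →
      C₂ a b r p q u v w ≠ ∞ → CesCesIneq a b r p q u v w (K * C₂ a b r p q u v w) := by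
  have hq : 0 < q := hp.trans_le hpq
  have hr : 0 < r := hp.trans_le hpr
  obtain ⟨K, hK, hblock⟩ := lintegral_block_le hp hq hq1 hr hr1
  refine ⟨(K * 4) ^ (1 / p) + 1, ENNReal.add_ne_top.2 ⟨ENNReal.rpow_ne_top_of_nonneg
    (by positivity) (ENNReal.mul_ne_top hK (by simp)), by simp⟩, by simp, ?_⟩
  intro a b hab u v w hu hv hw hW hC f hf
  rw [one_div q, ENNReal.rpow_inv_le_iff hq]
  refine lintegral_le_of_forall_left hab (div_pos hq hr) hu.1 _ fun c hc => ?_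
  obtain ⟨x, hx⟩ := exists_isDyadic hw.1 hc.2
    (fun t ht => (hW t ⟨hc.1.trans_le ht.1, ht.2⟩).1) (hW c hc).2.ne
  have hmain := (hx.rpow_lintegral_le_tsum hp hpq hpr (h := fun s => f s ^ r * v s) hu.1).trans
    (ENNReal.tsum_le_tsum fun k => hblock hu hv hW hC (y := x (k + 1)) (hx.mem k).1
      ⟨hc.1.trans_le (hx.mem k).1, (hx.mem k).2⟩ hf)
  rw [ENNReal.tsum_mul_left] at hmain
  have hsum := hx.tsum_rpow_mul_tail_le hc hp hw.1 f
  set R := ∫⁻ t in Ioo a b, (∫⁻ s in Ioo a t, f s) ^ p * w t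
  set D := C₂ a b r p q u v w
  have hL := hmain.trans (mul_le_mul_right hsum (K * D ^ p))
  rw [← inv_div q p, ENNReal.rpow_inv_le_iff (div_pos hq hp)] at hL
  refine hL.trans ?_
  calc (K * D ^ p * (4 * R)) ^ (q / p) = ((K * 4 * D ^ p * R) ^ (1 / p)) ^ q := by
        rw [← ENNReal.rpow_mul, one_div_mul_eq_div]
        congr 1
        ring
    _ = ((K * 4) ^ (1 / p) * D * R ^ (1 / p)) ^ q := by
        have h1 : 0 ≤ 1 / p := by positivity
        rw [ENNReal.mul_rpow_of_nonneg _ R h1, ENNReal.mul_rpow_of_nonneg _ (D ^ p) h1,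
          ← ENNReal.rpow_mul D, mul_one_div_cancel hp.ne', ENNReal.rpow_one]
    _ ≤ _ := by
        gcongr ((?_ * _) * _) ^ _
        exact le_self_add

/-- case (ii) of the main theorem: for `p ≤ q < 1`, `p ≤ r ≤ 1`,
the inequality holds iff `C₂ < ∞`, and the best constant satisfies `C ≈ C₂`. -/
theorem main_case_ii (p q r : ℝ) (hp0 : 0 < p) (hpq : p ≤ q) (hq1 : q < 1)
    (hpr : p ≤ r) (hr1 : r ≤ 1) :
    ∃ κ₁ κ₂ : ℝ≥0∞, 0 < κ₁ ∧ κ₂ < ∞ ∧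
    ∀ (a b : ℝ), a < b → ∀ u v w : ℝ → ℝ≥0∞,
      IsWeight a b u → IsWeight a b v → IsWeight a b w →
      (∀ x ∈ Set.Ioo a b,
        0 < (∫⁻ t in Set.Ioo x b, w t) ∧ (∫⁻ t in Set.Ioo x b, w t) < ∞) →
      (((∃ C : ℝ≥0∞, C < ∞ ∧ CesCesIneq a b r p q u v w C) ↔ C₂ a b r p q u v w < ∞) ∧
        κ₁ * C₂ a b r p q u v w ≤ BestC a b r p q u v w ∧
        BestC a b r p q u v w ≤ κ₂ * C₂ a b r p q u v w) := by
  obtain ⟨K, hK, hK0, hlow⟩ := C₂_le_of_CesCesIneq hp0 (hp0.trans_le hpq) hq1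
    (hp0.trans_le hpr) hr1
  obtain ⟨κ, hκ, hκ0, hup⟩ := exists_CesCesIneq hp0 hpq hq1 hpr hr1
  refine ⟨K⁻¹, κ, ENNReal.inv_pos.2 hK, hκ.lt_top, ?_⟩
  intro a b hab u v w hu hv hw hW
  refine ⟨⟨?_, fun h => ?_⟩, ?_, ?_⟩
  · rintro ⟨C, hC, h⟩
    exact (hlow hu hv hw hW h).trans_lt (ENNReal.mul_lt_top hK.lt_top hC)
  · exact ⟨_, ENNReal.mul_lt_top hκ.lt_top h, hup hab hu hv hw hW h.ne⟩
  · refine le_sInf fun C hC => ?_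
    rw [mul_comm, ← div_eq_mul_inv]
    exact ENNReal.div_le_of_le_mul' (hlow hu hv hw hW hC)
  · rcases eq_or_ne (C₂ a b r p q u v w) ∞ with h | h
    · rw [h, ENNReal.mul_top hκ0]
      exact le_top
    · exact sInf_le (hup hab hu hv hw hW h)
end
end
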